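/- arXiv:2512.21986 — 3 statements merged into one kernel-verified Lean document; each statement's English description precedes it below -/
import Mathlib

section
/- Let p ∈ [1,∞), let (μ_k)_{k∈ℕ} be a sequence in P_p(ℝ^{d+1}) and let μ ∈ P_p(ℝ^{d+1}). Then μ_k converges weakly in P_p(ℝ^{d+1}) to μ if and only if D_p(μ_k, μ) → 0 as k → ∞. -/
open MeasureTheory Filter Topology

noncomputable section

/-- The space `ℝ^{d+1} = ℝ^d × ℝ`, with last coordinate representing time. -/
abbrev Zsp (d : ℕ) : Type := (Fin d → ℝ) × ℝ

/-- The pseudometric `d_{p,w}((x,t),(y,s)) = (w‖x−y‖_p^p + (1−w)|t−s|^p)^{1/p}`. -/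
def dpw {d : ℕ} (p w : ℝ) (z z' : Zsp d) : ℝ :=
  (w * (∑ i, |z.1 i - z'.1 i| ^ p) + (1 - w) * |z.2 - z'.2| ^ p) ^ (1 / p)

/-- The metric `d_p((x,t),(y,s)) = (‖x−y‖_p^p + |t−s|^p)^{1/p}`. -/
def dPmet {d : ℕ} (p : ℝ) (z z' : Zsp d) : ℝ :=
  ((∑ i, |z.1 i - z'.1 i| ^ p) + |z.2 - z'.2| ^ p) ^ (1 / p)

/-- `μ ∈ P_p(ℝ^{d+1})`: a Borel probability measure with finite `p`-th moment w.r.t. `d_p`. -/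
def MemPp {d : ℕ} (p : ℝ) (μ : Measure (Zsp d)) : Prop :=
  IsProbabilityMeasure μ ∧ ∀ z0 : Zsp d, Integrable (fun z => dPmet p z0 z ^ p) μ

/-- `π ∈ Π(α,β)`: a coupling of `α` and `β`. -/
def IsCoupling {d : ℕ} (π : Measure (Zsp d × Zsp d)) (α β : Measure (Zsp d)) : Prop :=
  IsProbabilityMeasure π ∧ π.map Prod.fst = α ∧ π.map Prod.snd = β

/-- `W_{p,w}(α,β) = (inf_{π ∈ Π(α,β)} ∫ d_{p,w}(z,z')^p dπ)^{1/p}`. -/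
def Wpw {d : ℕ} (p w : ℝ) (α β : Measure (Zsp d)) : ℝ :=
  sInf {r : ℝ | ∃ π : Measure (Zsp d × Zsp d), IsCoupling π α β ∧
    r = ∫ z, dpw p w z.1 z.2 ^ p ∂π} ^ (1 / p)

/-- `W_p(α,β)`: the `p`-Wasserstein distance w.r.t. `d_p`. -/
def Wp {d : ℕ} (p : ℝ) (α β : Measure (Zsp d)) : ℝ :=
  sInf {r : ℝ | ∃ π : Measure (Zsp d × Zsp d), IsCoupling π α β ∧
    r = ∫ z, dPmet p z.1 z.2 ^ p ∂π} ^ (1 / p)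

/-- The Time-integrated Optimal Transport distance `D_p(α,β) = sup_{w ∈ [0,1]} W_{p,w}(α,β)`. -/
def Dp {d : ℕ} (p : ℝ) (α β : Measure (Zsp d)) : ℝ :=
  sSup {r : ℝ | ∃ w ∈ Set.Icc (0 : ℝ) 1, r = Wpw p w α β}

/-- Weak convergence in `P_p(ℝ^{d+1})`. -/
def WeakConvPp {d : ℕ} (p : ℝ) (μs : ℕ → Measure (Zsp d)) (μ : Measure (Zsp d)) : Prop :=
  (∀ φ : BoundedContinuousFunction (Zsp d) ℝ,
      Tendsto (fun k => ∫ z, φ z ∂(μs k)) atTop (𝓝 (∫ z, φ z ∂μ))) ∧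
  (∀ z0 : Zsp d,
      Tendsto (fun k => ∫ z, dPmet p z0 z ^ p ∂(μs k)) atTop
        (𝓝 (∫ z, dPmet p z0 z ^ p ∂μ)))


lemma aux_density_coupling {X : Type*} [MeasurableSpace X] (α β : Measure X)
    [IsProbabilityMeasure α] [IsProbabilityMeasure β] (ρ : X × X → ℝ) (hm : Measurable ρ)
    (h0 : ∀ z, 0 ≤ ρ z) (hi : Integrable ρ (α.prod β))
    (h1 : ∀ᵐ x ∂α, ∫ y, ρ (x, y) ∂β = 1)
    (h2 : ∀ᵐ y ∂β, ∫ x, ρ (x, y) ∂α = 1) :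
    ∃ π : Measure (X × X), IsProbabilityMeasure π ∧ π.map Prod.fst = α ∧ π.map Prod.snd = β ∧
      ∀ f : X × X → ℝ, ∫ z, f z ∂π = ∫ z, f z * ρ z ∂(α.prod β) := by
  have hm' : Measurable fun z => ENNReal.ofReal (ρ z) := hm.ennreal_ofReal
  have e1 : ((α.prod β).withDensity fun z => ENNReal.ofReal (ρ z)).map Prod.fst = α := by
    ext A hA
    rw [Measure.map_apply measurable_fst hA, withDensity_apply _ (measurable_fst hA),
      ← lintegral_indicator (measurable_fst hA), lintegral_prod _
        (hm'.indicator (measurable_fst hA)).aemeasurable]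
    have : ∀ᵐ x ∂α, (∫⁻ y, (Prod.fst ⁻¹' A : Set (X × X)).indicator
        (fun z => ENNReal.ofReal (ρ z)) (x, y) ∂β) = A.indicator 1 x := by
      filter_upwards [h1, hi.prod_right_ae] with x hx hxi
      by_cases hxA : x ∈ A
      · simp only [Set.indicator, Set.mem_preimage, hxA, if_true, Pi.one_apply]
        rw [← ofReal_integral_eq_lintegral_ofReal hxi (ae_of_all _ fun y => h0 _), hx]
        simp
      · simp [Set.indicator, hxA]
    rw [lintegral_congr_ae this, lintegral_indicator_one hA]
  have e2 : ((α.prod β).withDensity fun z => ENNReal.ofReal (ρ z)).map Prod.snd = β := by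
    ext A hA
    rw [Measure.map_apply measurable_snd hA, withDensity_apply _ (measurable_snd hA),
      ← lintegral_indicator (measurable_snd hA), lintegral_prod_symm _
        (hm'.indicator (measurable_snd hA)).aemeasurable]
    have : ∀ᵐ y ∂β, (∫⁻ x, (Prod.snd ⁻¹' A : Set (X × X)).indicator
        (fun z => ENNReal.ofReal (ρ z)) (x, y) ∂α) = A.indicator 1 y := by
      filter_upwards [h2, hi.prod_left_ae] with x hx hxi
      by_cases hxA : x ∈ A
      · simp only [Set.indicator, Set.mem_preimage, hxA, if_true, Pi.one_apply]
        rw [← ofReal_integral_eq_lintegral_ofReal hxi (ae_of_all _ fun y => h0 _), hx]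
        simp
      · simp [Set.indicator, hxA]
    rw [lintegral_congr_ae this, lintegral_indicator_one hA]
  refine ⟨(α.prod β).withDensity fun z => ENNReal.ofReal (ρ z), ?_, e1, e2, ?_⟩
  · constructor
    have := congrArg (fun m => m Set.univ) e1
    simpa [Measure.map_apply measurable_fst MeasurableSet.univ] using this
  · intro f
    rw [integral_withDensity_eq_integral_toReal_smul hm' (by simp)]
    refine integral_congr_ae (ae_of_all _ fun z => ?_)
    simp [ENNReal.toReal_ofReal (h0 z), mul_comm]

lemma aux_bdd_mul {X : Type*} [MeasurableSpace X] {α : Measure X} {f g : X → ℝ}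
    (hf : Integrable f α) (hg : Measurable g) (h0 : ∀ x, 0 ≤ g x) (h1 : ∀ x, g x ≤ 1) :
    Integrable (fun x => f x * g x) α := by
  refine hf.mul_bdd (c := 1) hg.aestronglyMeasurable (ae_of_all _ fun x => ?_)
  rw [Real.norm_eq_abs, abs_of_nonneg (h0 x)]; exact h1 x

/-- Half of the remainder estimate. -/
lemma aux_rem {X ι : Type*} [MeasurableSpace X] [Fintype ι] (α : Measure X)
    [IsProbabilityMeasure α] (φ : ι → X → ℝ) (hφm : ∀ i, Measurable (φ i))
    (h0 : ∀ i x, 0 ≤ φ i x) (hs : ∀ x, ∑ i, φ i x ≤ 1) (g : X → ℝ) (hg : Integrable g α)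
    (R : ℝ) (hR : ∀ i x, φ i x ≠ 0 → g x ≤ R) (m : ι → ℝ) (hm0 : ∀ i, 0 ≤ m i)
    (hm : ∀ i, m i ≤ ∫ x, φ i x ∂α) :
    ∫ x, g x * (1 - ∑ i, m i / (∫ x, φ i x ∂α) * φ i x) ∂α ≤
      ∫ x, g x * (1 - ∑ i, φ i x) ∂α + ∑ i, R * ((∫ x, φ i x ∂α) - m i) := by
  have h1 : ∀ i x, φ i x ≤ 1 := fun i x =>
    (Finset.single_le_sum (f := fun i => φ i x) (fun j _ => h0 j x) (Finset.mem_univ i)).trans (hs x)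
  have hgi : ∀ i, Integrable (fun x => g x * φ i x) α := fun i =>
    aux_bdd_mul hg (hφm i) (h0 i) (h1 i)
  have hφi : ∀ i, Integrable (φ i) α := fun i => by
    simpa using aux_bdd_mul (integrable_const (1 : ℝ)) (hφm i) (h0 i) (h1 i) (α := α)
  have e : ∀ x, g x * (1 - ∑ i, m i / (∫ x, φ i x ∂α) * φ i x) =
      g x * (1 - ∑ i, φ i x) + ∑ i, (1 - m i / (∫ x, φ i x ∂α)) * (g x * φ i x) := by
    intro x
    simp only [sub_mul, one_mul, Finset.sum_sub_distrib, mul_sub, Finset.mul_sum]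
    have : ∀ i, m i / (∫ x, φ i x ∂α) * (g x * φ i x) = g x * (m i / (∫ x, φ i x ∂α) * φ i x) :=
      fun i => by ring
    simp only [this]; ring
  simp_rw [e]
  rw [integral_add, integral_finsetSum]
  · gcongr with i
    rw [integral_const_mul]
    have ha : 0 ≤ ∫ x, φ i x ∂α := (hm0 i).trans (hm i)
    have hle : ∫ x, g x * φ i x ∂α ≤ R * ∫ x, φ i x ∂α := by
      rw [← integral_const_mul]
      refine integral_mono (hgi i) ((hφi i).const_mul R) fun x => ?_
      by_cases hx : φ i x = 0
      · simp [hx]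
      · exact mul_le_mul_of_nonneg_right (hR i x hx) (h0 i x)
    have hd : 0 ≤ 1 - m i / (∫ x, φ i x ∂α) := by
      have := div_le_one_of_le₀ (hm i) ha
      linarith
    refine (mul_le_mul_of_nonneg_left hle hd).trans (le_of_eq ?_)
    by_cases hz : ∫ x, φ i x ∂α = 0
    · have : m i = 0 := le_antisymm (hz ▸ hm i) (hm0 i)
      simp [hz, this]
    · field_simp
  · exact fun i _ => (hgi i).const_mul _
  · have : ∀ x, g x * (1 - ∑ i, φ i x) = g x - ∑ i, g x * φ i x := fun x => by
      rw [mul_sub, mul_one, Finset.mul_sum]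
    simp_rw [this]
    exact hg.sub (integrable_finsetSum _ fun i _ => hgi i)
  · exact integrable_finsetSum _ fun i _ => (hgi i).const_mul _

lemma aux_coupling {X ι : Type*} [MeasurableSpace X] [Fintype ι] (α β : Measure X)
    [IsProbabilityMeasure α] [IsProbabilityMeasure β] (φ : ι → X → ℝ)
    (hφm : ∀ i, Measurable (φ i))
    (h0 : ∀ i x, 0 ≤ φ i x) (hs : ∀ x, ∑ i, φ i x ≤ 1) (g : X → ℝ) (hg0 : ∀ x, 0 ≤ g x)
    (hgα : Integrable g α) (hgβ : Integrable g β)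
    (R : ℝ) (hR : ∀ i x, φ i x ≠ 0 → g x ≤ R) (c : X × X → ℝ)
    (hc0 : ∀ z, 0 ≤ c z) (C : ℝ) (hC0 : 0 ≤ C) (hC : ∀ x y, c (x, y) ≤ C * (g x + g y))
    (ε : ℝ) (hε : 0 ≤ ε) (hcε : ∀ i x y, φ i x ≠ 0 → φ i y ≠ 0 → c (x, y) ≤ ε) :
    ∃ π : Measure (X × X), IsProbabilityMeasure π ∧ π.map Prod.fst = α ∧ π.map Prod.snd = β ∧
      ∫ z, c z ∂π ≤ ε + C * (∫ x, g x * (1 - ∑ i, φ i x) ∂α + ∫ x, g x * (1 - ∑ i, φ i x) ∂β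
        + ∑ i, R * |(∫ x, φ i x ∂α) - ∫ x, φ i x ∂β|) := by
  have h1 : ∀ i x, φ i x ≤ 1 := fun i x =>
    (Finset.single_le_sum (f := fun i => φ i x) (fun j _ => h0 j x) (Finset.mem_univ i)).trans (hs x)
  have hφα : ∀ i, Integrable (φ i) α := fun i => by
    simpa using aux_bdd_mul (integrable_const (1 : ℝ)) (hφm i) (h0 i) (h1 i) (α := α)
  have hφβ : ∀ i, Integrable (φ i) β := fun i => by
    simpa using aux_bdd_mul (integrable_const (1 : ℝ)) (hφm i) (h0 i) (h1 i) (α := β)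
  set a : ι → ℝ := fun i => ∫ x, φ i x ∂α with ha
  set b : ι → ℝ := fun i => ∫ x, φ i x ∂β with hb
  have ha0 : ∀ i, 0 ≤ a i := fun i => integral_nonneg (h0 i)
  have hb0 : ∀ i, 0 ≤ b i := fun i => integral_nonneg (h0 i)
  set m : ι → ℝ := fun i => min (a i) (b i) with hm
  have hm0 : ∀ i, 0 ≤ m i := fun i => le_min (ha0 i) (hb0 i)
  have hma : ∀ i, m i ≤ a i := fun i => min_le_left _ _
  have hmb : ∀ i, m i ≤ b i := fun i => min_le_right _ _
  have hma1 : ∀ i, m i / a i * a i = m i := fun i => by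
    by_cases hz : a i = 0
    · have : m i = 0 := le_antisymm (hz ▸ hma i) (hm0 i)
      simp [this]
    · field_simp
  have hmb1 : ∀ i, m i / b i * b i = m i := fun i => by
    by_cases hz : b i = 0
    · have : m i = 0 := le_antisymm (hz ▸ hmb i) (hm0 i)
      simp [this]
    · field_simp
  set u : X → ℝ := fun x => 1 - ∑ i, m i / a i * φ i x with hu
  set v : X → ℝ := fun x => 1 - ∑ i, m i / b i * φ i x with hv
  have hq : ∀ (t : ι → ℝ), (∀ i, 0 ≤ t i) → (∀ i, t i ≤ 1) → ∀ x,
      0 ≤ 1 - ∑ i, t i * φ i x ∧ 1 - ∑ i, t i * φ i x ≤ 1 := by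
    intro t ht0 ht1 x
    have e1 : 0 ≤ ∑ i, t i * φ i x := Finset.sum_nonneg fun i _ => mul_nonneg (ht0 i) (h0 i x)
    have e2 : ∑ i, t i * φ i x ≤ ∑ i, φ i x := Finset.sum_le_sum fun i _ =>
      mul_le_of_le_one_left (h0 i x) (ht1 i)
    have := hs x
    constructor <;> linarith
  have hu01 : ∀ x, 0 ≤ u x ∧ u x ≤ 1 := hq _ (fun i => div_nonneg (hm0 i) (ha0 i))
    (fun i => div_le_one_of_le₀ (hma i) (ha0 i))
  have hv01 : ∀ x, 0 ≤ v x ∧ v x ≤ 1 := hq _ (fun i => div_nonneg (hm0 i) (hb0 i))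
    (fun i => div_le_one_of_le₀ (hmb i) (hb0 i))
  have hum : Measurable u := by fun_prop
  have hvm : Measurable v := by fun_prop
  have hui : Integrable u α := by
    simpa using aux_bdd_mul (integrable_const (1 : ℝ)) hum (fun x => (hu01 x).1) (fun x => (hu01 x).2) (α := α)
  have hvi : Integrable v β := by
    simpa using aux_bdd_mul (integrable_const (1 : ℝ)) hvm (fun x => (hv01 x).1) (fun x => (hv01 x).2) (α := β)
  set M : ℝ := 1 - ∑ i, m i with hM
  have huM : ∫ x, u x ∂α = M := by
    rw [hu, integral_sub (integrable_const _) (integrable_finsetSum _ fun i _ => (hφα i).const_mul _),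
      integral_finsetSum _ fun i _ => (hφα i).const_mul _]
    simp_rw [integral_const_mul]
    simp only [integral_const, probReal_univ, smul_eq_mul, mul_one, hM]
    congr 1
    exact Finset.sum_congr rfl fun i _ => hma1 i
  have hvM : ∫ x, v x ∂β = M := by
    rw [hv, integral_sub (integrable_const _) (integrable_finsetSum _ fun i _ => (hφβ i).const_mul _),
      integral_finsetSum _ fun i _ => (hφβ i).const_mul _]
    simp_rw [integral_const_mul]
    simp only [integral_const, probReal_univ, smul_eq_mul, mul_one, hM]
    congr 1
    exact Finset.sum_congr rfl fun i _ => hmb1 i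
  have hM0 : 0 ≤ M := huM ▸ integral_nonneg fun x => (hu01 x).1
  have hsum1 : ∑ i, m i ≤ 1 := by linarith
  set k : ι → ℝ := fun i => m i / (a i * b i) with hk
  have hk0 : ∀ i, 0 ≤ k i := fun i => div_nonneg (hm0 i) (mul_nonneg (ha0 i) (hb0 i))
  have hkb : ∀ i, k i * b i = m i / a i := fun i => by
    rw [hk]; simp only
    rw [← div_div, div_right_comm, div_mul_eq_mul_div, hmb1]
  have hka : ∀ i, k i * a i = m i / b i := fun i => by
    rw [hk]; simp only
    rw [← div_div, div_mul_eq_mul_div, hma1]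
  set ρ : X × X → ℝ := fun z => (∑ i, k i * (φ i z.1 * φ i z.2)) + M⁻¹ * (u z.1 * v z.2) with hρ
  have hρm : Measurable ρ := by fun_prop
  have hρ0 : ∀ z, 0 ≤ ρ z := fun z => add_nonneg
    (Finset.sum_nonneg fun i _ => mul_nonneg (hk0 i) (mul_nonneg (h0 i _) (h0 i _)))
    (mul_nonneg (inv_nonneg.2 hM0) (mul_nonneg (hu01 _).1 (hv01 _).1))
  have hρi : Integrable ρ (α.prod β) :=
    (integrable_finsetSum _ fun i _ => ((hφα i).mul_prod (hφβ i)).const_mul _).add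
      ((hui.mul_prod hvi).const_mul _)
  have hr1 : ∀ᵐ x ∂α, ∫ y, ρ (x, y) ∂β = 1 := by
    have e : ∀ x, ∫ y, ρ (x, y) ∂β = 1 - u x + M⁻¹ * M * u x := by
      intro x
      simp only [hρ]
      rw [integral_add (integrable_finsetSum _ fun i _ => ((hφβ i).const_mul _).const_mul _)
        ((hvi.const_mul _).const_mul _), integral_finsetSum _ fun i _ => ((hφβ i).const_mul _).const_mul _]
      simp_rw [integral_const_mul]
      rw [hvM]
      have : ∀ i, k i * (φ i x * ∫ y, φ i y ∂β) = m i / a i * φ i x := fun i => by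
        rw [← hkb]; simp only [hb]; ring
      simp_rw [this, hu]
      ring
    by_cases hMz : M = 0
    · have : u =ᵐ[α] 0 := (integral_eq_zero_iff_of_nonneg (fun x => (hu01 x).1) hui).1 (huM.trans hMz)
      filter_upwards [this] with x hx
      rw [e, hx]; simp
    · refine ae_of_all _ fun x => ?_
      rw [e, inv_mul_cancel₀ hMz]; ring
  have hr2 : ∀ᵐ y ∂β, ∫ x, ρ (x, y) ∂α = 1 := by
    have e : ∀ y, ∫ x, ρ (x, y) ∂α = 1 - v y + M⁻¹ * M * v y := by
      intro y
      simp only [hρ]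
      rw [integral_add (integrable_finsetSum _ fun i _ => ((hφα i).mul_const _).const_mul _)
        ((hui.mul_const _).const_mul _), integral_finsetSum _ fun i _ => ((hφα i).mul_const _).const_mul _]
      simp_rw [integral_const_mul, integral_mul_const]
      rw [huM]
      have : ∀ i, k i * ((∫ x, φ i x ∂α) * φ i y) = m i / b i * φ i y := fun i => by
        rw [← hka]; simp only [ha]; ring
      simp_rw [this, hv]
      ring
    by_cases hMz : M = 0
    · have : v =ᵐ[β] 0 := (integral_eq_zero_iff_of_nonneg (fun x => (hv01 x).1) hvi).1 (hvM.trans hMz)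
      filter_upwards [this] with x hx
      rw [e, hx]; simp
    · refine ae_of_all _ fun x => ?_
      rw [e, inv_mul_cancel₀ hMz]; ring
  obtain ⟨π, hπ, hπ1, hπ2, hπ3⟩ := aux_density_coupling α β ρ hρm hρ0 hρi hr1 hr2
  refine ⟨π, hπ, hπ1, hπ2, ?_⟩
  rw [hπ3]
  have hgu : Integrable (fun x => g x * u x) α :=
    aux_bdd_mul hgα hum (fun x => (hu01 x).1) (fun x => (hu01 x).2)
  have hgv : Integrable (fun x => g x * v x) β :=
    aux_bdd_mul hgβ hvm (fun x => (hv01 x).1) (fun x => (hv01 x).2)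
  have hI1 : Integrable (fun z : X × X => ε * ∑ i, k i * (φ i z.1 * φ i z.2)) (α.prod β) :=
    (integrable_finsetSum _ fun i _ => ((hφα i).mul_prod (hφβ i)).const_mul _).const_mul _
  have hI2 : Integrable (fun z : X × X => C * M⁻¹ * ((g z.1 * u z.1) * v z.2)) (α.prod β) :=
    (hgu.mul_prod hvi).const_mul _
  have hI3 : Integrable (fun z : X × X => C * M⁻¹ * (u z.1 * (g z.2 * v z.2))) (α.prod β) :=
    (hui.mul_prod hgv).const_mul _
  have hpt : ∀ z : X × X, c z * ρ z ≤ ε * (∑ i, k i * (φ i z.1 * φ i z.2)) +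
      C * M⁻¹ * ((g z.1 * u z.1) * v z.2) + C * M⁻¹ * (u z.1 * (g z.2 * v z.2)) := by
    rintro ⟨x, y⟩
    have p1 : c (x, y) * ∑ i, k i * (φ i x * φ i y) ≤ ε * ∑ i, k i * (φ i x * φ i y) := by
      rw [Finset.mul_sum, Finset.mul_sum]
      refine Finset.sum_le_sum fun i _ => ?_
      by_cases hx : φ i x = 0
      · simp [hx]
      by_cases hy : φ i y = 0
      · simp [hy]
      exact mul_le_mul_of_nonneg_right (hcε i x y hx hy)
        (mul_nonneg (hk0 i) (mul_nonneg (h0 i _) (h0 i _)))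
    have p2 : c (x, y) * (M⁻¹ * (u x * v y)) ≤ C * (g x + g y) * (M⁻¹ * (u x * v y)) :=
      mul_le_mul_of_nonneg_right (hC x y)
        (mul_nonneg (inv_nonneg.2 hM0) (mul_nonneg (hu01 _).1 (hv01 _).1))
    simp only [hρ, mul_add]
    calc _ ≤ _ := add_le_add p1 p2
      _ = _ := by ring
  have hstep := integral_mono_of_nonneg (μ := α.prod β)
    (ae_of_all _ fun z => mul_nonneg (hc0 z) (hρ0 z)) ((hI1.add hI2).add hI3) (ae_of_all _ hpt)
  refine hstep.trans ?_
  rw [integral_add' (hI1.add hI2) hI3, integral_add' hI1 hI2]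
  simp_rw [integral_const_mul]
  rw [integral_finsetSum _ fun i _ => ((hφα i).mul_prod (hφβ i)).const_mul _]
  simp_rw [integral_const_mul]
  rw [integral_prod_mul (fun x => g x * u x) v, integral_prod_mul u (fun x => g x * v x), huM, hvM]
  have hkab : ∑ i, k i * ∫ z, φ i z.1 * φ i z.2 ∂(α.prod β) = ∑ i, m i := by
    refine Finset.sum_congr rfl fun i _ => ?_
    rw [integral_prod_mul (φ i) (φ i)]
    change k i * (a i * b i) = _
    rw [← mul_assoc, hka, hmb1]
  rw [hkab]
  have r1 := aux_rem α φ hφm h0 hs g hgα R hR m hm0 hma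
  have r2 := aux_rem β φ hφm h0 hs g hgβ R hR m hm0 hmb
  have q1 : 0 ≤ ∫ x, g x * u x ∂α := integral_nonneg fun x => mul_nonneg (hg0 x) (hu01 x).1
  have q2 : 0 ≤ ∫ x, g x * v x ∂β := integral_nonneg fun x => mul_nonneg (hg0 x) (hv01 x).1
  have hMM : M⁻¹ * M ≤ 1 := by
    by_cases hMz : M = 0
    · simp [hMz]
    · rw [inv_mul_cancel₀ hMz]
  have habs : ∑ i, R * (a i - m i) + ∑ i, R * (b i - m i) = ∑ i, R * |a i - b i| := by
    rw [← Finset.sum_add_distrib]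
    refine Finset.sum_congr rfl fun i _ => ?_
    simp only [hm]
    rcases le_total (a i) (b i) with h | h
    · rw [min_eq_left h, abs_of_nonpos (by linarith)]; ring
    · rw [min_eq_right h, abs_of_nonneg (by linarith)]; ring
  calc ε * ∑ i, m i + C * M⁻¹ * ((∫ x, g x * u x ∂α) * M) + C * M⁻¹ * (M * ∫ x, g x * v x ∂β)
      = ε * ∑ i, m i + (M⁻¹ * M) * (C * ((∫ x, g x * u x ∂α) + ∫ x, g x * v x ∂β)) := by ring
    _ ≤ ε + C * ((∫ x, g x * u x ∂α) + ∫ x, g x * v x ∂β) := by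
      refine add_le_add (mul_le_of_le_one_right hε hsum1) (mul_le_of_le_one_left ?_ hMM)
      positivity
    _ ≤ _ := by
      refine add_le_add le_rfl (mul_le_mul_of_nonneg_left ?_ hC0)
      change _ ≤ _ + _ + ∑ i, R * |a i - b i|
      rw [← habs]
      change (∫ x, g x * u x ∂α) ≤ _ at r1
      change (∫ x, g x * v x ∂β) ≤ _ at r2
      linarith

lemma aux_partition {X : Type*} [MetricSpace X] (c : X × X → ℝ) (hc : Continuous c)
    (hcd : ∀ x, c (x, x) = 0) (g : X → ℝ) (hg : Continuous g) (ε : ℝ) (hε : 0 < ε)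
    (K : Set X) (hK : IsCompact K) :
    ∃ (s : Finset X) (φ : s → X → ℝ) (R : ℝ), (∀ i, Continuous (φ i)) ∧ (∀ i x, 0 ≤ φ i x) ∧
      (∀ x, ∑ i, φ i x ≤ 1) ∧ (∀ x ∈ K, ∑ i, φ i x = 1) ∧ (∀ i x, φ i x ≠ 0 → g x ≤ R) ∧
      (∀ i x y, φ i x ≠ 0 → φ i y ≠ 0 → c (x, y) ≤ ε) := by
  have hU : ∀ x, ∃ U : Set X, IsOpen U ∧ x ∈ U ∧ (∀ y ∈ U, g y ≤ g x + 1) ∧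
      ∀ y ∈ U, ∀ z ∈ U, c (y, z) ≤ ε := by
    intro x
    have h1 : ∀ᶠ z in 𝓝 (x, x), c z < ε :=
      (hc.tendsto (x, x)).eventually (gt_mem_nhds (by rw [hcd]; exact hε))
    have h2 : ∀ᶠ y in 𝓝 x, g y < g x + 1 :=
      (hg.tendsto x).eventually (gt_mem_nhds (by linarith))
    rw [nhds_prod_eq, eventually_prod_self_iff (r := fun a b => c (a, b) < ε)] at h1
    obtain ⟨t, ht, ht'⟩ := h1
    obtain ⟨U, hUs, hUo, hxU⟩ := mem_nhds_iff.1 (inter_mem ht h2)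
    exact ⟨U, hUo, hxU, fun y hy => le_of_lt (hUs hy).2,
      fun y hy z hz => le_of_lt (ht' y (hUs hy).1 z (hUs hz).1)⟩
  choose U hUo hxU hUg hUc using hU
  obtain ⟨s, hs⟩ := hK.elim_finite_subcover U hUo
    (fun x _ => Set.mem_iUnion.2 ⟨x, hxU x⟩)
  obtain ⟨f, hf⟩ := PartitionOfUnity.exists_isSubordinate_of_locallyFinite hK.isClosed
    (fun i : s => U i) (fun i => hUo i) (locallyFinite_of_finite _) (by
      intro x hx
      obtain ⟨i, hi, hxi⟩ := Set.mem_iUnion₂.1 (hs hx)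
      exact Set.mem_iUnion.2 ⟨⟨i, hi⟩, hxi⟩)
  have hsub : ∀ i x, f i x ≠ 0 → x ∈ U i := fun i x hx =>
    hf i (subset_tsupport _ hx)
  refine ⟨s, fun i x => f i x, ∑ i ∈ s, |g i + 1|, fun i => (f i).continuous, fun i x => f.nonneg i x, 
    fun x => ?_, fun x hx => ?_, fun i x hx => ?_, fun i x y hx hy => ?_⟩
  · rw [← finsum_eq_sum_of_fintype]; exact f.sum_le_one x
  · rw [← finsum_eq_sum_of_fintype]; exact f.sum_eq_one hx
  · refine (hUg _ _ (hsub i x hx)).trans ((le_abs_self _).trans ?_)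
    exact Finset.single_le_sum (f := fun i => |g i + 1|) (fun j _ => abs_nonneg _) i.2
  · exact hUc _ _ (hsub i x hx) _ (hsub i y hy)

lemma aux_forward {X : Type*} [MetricSpace X] [ProperSpace X] [Nonempty X] [MeasurableSpace X]
    [BorelSpace X] [SecondCountableTopology X]
    (c : X × X → ℝ) (hc : Continuous c)
    (hcd : ∀ x, c (x, x) = 0) (hc0 : ∀ z, 0 ≤ c z) (g : X → ℝ) (hg : Continuous g)
    (hg0 : ∀ x, 0 ≤ g x) (C : ℝ) (hC0 : 0 ≤ C) (hC : ∀ x y, c (x, y) ≤ C * (g x + g y))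
    (μs : ℕ → Measure X) (μ : Measure X) [∀ k, IsProbabilityMeasure (μs k)]
    [IsProbabilityMeasure μ] (hgk : ∀ k, Integrable g (μs k)) (hgμ : Integrable g μ)
    (hw : ∀ φ : BoundedContinuousFunction X ℝ,
      Tendsto (fun k => ∫ z, φ z ∂(μs k)) atTop (𝓝 (∫ z, φ z ∂μ)))
    (hgc : Tendsto (fun k => ∫ z, g z ∂(μs k)) atTop (𝓝 (∫ z, g z ∂μ)))
    (ε : ℝ) (hε : 0 < ε) :
    ∀ᶠ k in atTop, ∃ π : Measure (X × X), IsProbabilityMeasure π ∧ π.map Prod.fst = μs k ∧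
      π.map Prod.snd = μ ∧ ∫ z, c z ∂π < ε := by
  obtain ⟨x0⟩ := ‹Nonempty X›
  have hwf : ∀ (f : X → ℝ), Continuous f → ∀ B : ℝ, (∀ x, |f x| ≤ B) →
      Tendsto (fun k => ∫ z, f z ∂(μs k)) atTop (𝓝 (∫ z, f z ∂μ)) := by
    intro f hf B hB
    exact hw (BoundedContinuousFunction.ofNormedAddCommGroup f hf B hB)
  obtain ⟨η, hη, hη'⟩ : ∃ η > 0, ε / 2 + C * (2 * η) < ε := by
    refine ⟨ε / (8 * (C + 1)), by positivity, ?_⟩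
    have : C * (2 * (ε / (8 * (C + 1)))) = (ε / 4) * (C / (C + 1)) := by field_simp; ring
    rw [this]
    have h2 : C / (C + 1) ≤ 1 := div_le_one_of_le₀ (by linarith) (by linarith)
    nlinarith
  obtain ⟨n, hn⟩ : ∃ n : ℕ, ∫ x in (Metric.closedBall x0 (n : ℝ))ᶜ, g x ∂μ < η := by
    have ht := tendsto_setIntegral_of_antitone (μ := μ) (f := g)
      (s := fun n : ℕ => (Metric.closedBall x0 (n : ℝ))ᶜ)
      (fun n => Metric.isClosed_closedBall.measurableSet.compl)
      (fun a b hab => Set.compl_subset_compl.2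
        (Metric.closedBall_subset_closedBall (by exact_mod_cast hab))) ⟨0, hgμ.integrableOn⟩
    have he : (⋂ n : ℕ, (Metric.closedBall x0 (n : ℝ))ᶜ) = ∅ := by
      rw [← Set.compl_iUnion, Metric.iUnion_closedBall_nat, Set.compl_univ]
    rw [he] at ht
    simp only [Measure.restrict_empty, integral_zero_measure] at ht
    exact (ht.eventually (gt_mem_nhds hη)).exists
  obtain ⟨s, φ, R, hφc, hφ0, hφ1, hφK, hφR, hφε⟩ := aux_partition c hc hcd g hg (ε / 2)
    (by positivity) (Metric.closedBall x0 (n : ℝ)) (isCompact_closedBall _ _)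
  have hφle : ∀ i x, φ i x ≤ 1 := fun i x =>
    (Finset.single_le_sum (f := fun i => φ i x) (fun j _ => hφ0 j x) (Finset.mem_univ i)).trans
      (hφ1 x)
  have hψ : Continuous fun x => ∑ i, φ i x := continuous_finsetSum _ fun i _ => hφc i
  have hψ0 : ∀ x, 0 ≤ ∑ i, φ i x := fun x => Finset.sum_nonneg fun i _ => hφ0 i x
  have hsmall : ∫ x, g x * (1 - ∑ i, φ i x) ∂μ < η := by
    refine lt_of_le_of_lt ?_ hn
    rw [← integral_indicator Metric.isClosed_closedBall.measurableSet.compl]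
    refine integral_mono_of_nonneg
      (ae_of_all _ fun x => mul_nonneg (hg0 x) (by have := hφ1 x; linarith))
      (hgμ.indicator Metric.isClosed_closedBall.measurableSet.compl) (ae_of_all _ fun x => ?_)
    by_cases hx : x ∈ Metric.closedBall x0 (n : ℝ)
    · simp only [hφK x hx]; simp [hx]
    · simp only [Set.indicator, Set.mem_compl_iff, hx, not_false_eq_true, if_true]
      exact mul_le_of_le_one_right (hg0 x) (by have := hψ0 x; linarith)
  have e1 : ∀ (ν : Measure X), Integrable g ν → ∫ x, g x * (1 - ∑ i, φ i x) ∂ν =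
      ∫ x, g x ∂ν - ∫ x, g x * ∑ i, φ i x ∂ν := by
    intro ν hν
    rw [← integral_sub hν (aux_bdd_mul hν hψ.measurable hψ0 hφ1)]
    exact integral_congr_ae (ae_of_all _ fun x => by simp only; ring)
  have t1 : Tendsto (fun k => ∫ x, g x * (1 - ∑ i, φ i x) ∂(μs k)) atTop
      (𝓝 (∫ x, g x * (1 - ∑ i, φ i x) ∂μ)) := by
    rw [e1 μ hgμ]
    simp_rw [e1 _ (hgk _)]
    refine hgc.sub (hwf _ (hg.mul hψ) (|R|) fun x => ?_)
    rw [abs_of_nonneg (mul_nonneg (hg0 x) (hψ0 x))]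
    by_cases hx : ∃ i, φ i x ≠ 0
    · obtain ⟨i, hi⟩ := hx
      exact (mul_le_of_le_one_right (hg0 x) (hφ1 x)).trans ((hφR i x hi).trans (le_abs_self R))
    · push Not at hx
      simp [hx]
  have t2 : Tendsto (fun k => ∑ i, R * |(∫ x, φ i x ∂(μs k)) - ∫ x, φ i x ∂μ|) atTop
      (𝓝 (∑ i : s, R * |(∫ x, φ i x ∂μ) - ∫ x, φ i x ∂μ|)) := by
    refine tendsto_finsetSum _ fun i _ => Tendsto.const_mul _ (Tendsto.abs (Tendsto.sub ?_
      tendsto_const_nhds))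
    exact hwf _ (hφc i) 1 fun x => by rw [abs_of_nonneg (hφ0 i x)]; exact hφle i x
  have t3 := (((t1.add (tendsto_const_nhds (x := ∫ x, g x * (1 - ∑ i, φ i x) ∂μ))).add t2).const_mul C).const_add (ε / 2)
  have hlim : ε / 2 + C * (∫ x, g x * (1 - ∑ i, φ i x) ∂μ + ∫ x, g x * (1 - ∑ i, φ i x) ∂μ +
      (∑ i : s, R * |(∫ x, φ i x ∂μ) - ∫ x, φ i x ∂μ|)) < ε := by
    simp only [sub_self, abs_zero, mul_zero, Finset.sum_const_zero, add_zero]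
    refine lt_of_le_of_lt ?_ hη'
    gcongr
    linarith
  filter_upwards [t3.eventually (gt_mem_nhds hlim)] with k hk
  obtain ⟨π, h1, h2, h3, h4⟩ := aux_coupling (μs k) μ φ (fun i => (hφc i).measurable) hφ0 hφ1 g hg0
    (hgk k) hgμ R hφR c hc0 C hC0 hC (ε / 2) (by positivity) hφε
  exact ⟨π, h1, h2, h3, h4.trans_lt hk⟩

lemma aux_moment {X : Type*} [MeasurableSpace X] (p : ℝ) (hp : 1 ≤ p) (f : X → ℝ)
    (hf : Measurable f) (c : X × X → ℝ) (hfc : ∀ z : X × X, |f z.1 - f z.2| ^ p ≤ c z)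
    (μs : ℕ → Measure X) (μ : Measure X) (π : ℕ → Measure (X × X))
    (h1 : ∀ k, (π k).map Prod.fst = μs k) (h2 : ∀ k, (π k).map Prod.snd = μ)
    (hci : ∀ k, Integrable c (π k)) (hct : Tendsto (fun k => ∫ z, c z ∂(π k)) atTop (𝓝 0))
    (hi : ∀ k, Integrable (fun x => |f x| ^ p) (μs k)) (hi' : Integrable (fun x => |f x| ^ p) μ) :
    Tendsto (fun k => ∫ x, |f x| ^ p ∂(μs k)) atTop (𝓝 (∫ x, |f x| ^ p ∂μ)) := by
  have hp0 : 0 < p := by linarith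
  set q : ENNReal := ENNReal.ofReal p with hq
  have hq0 : q ≠ 0 := by simp [hq, hp0]
  have hqt : q ≠ ⊤ := by simp [hq]
  have hq1 : 1 ≤ q := by simpa [hq] using hp
  have hqr : q.toReal = p := ENNReal.toReal_ofReal hp0.le
  have key : ∀ (ν : Measure (X × X)) (h : X × X → ℝ), Measurable h →
      lpNorm h q ν = (∫ x, |h x| ^ p ∂ν) ^ p⁻¹ := by
    intro ν h hh
    rw [lpNorm_eq_integral_norm_rpow_toReal hq0 hqt hh.aestronglyMeasurable, hqr]
    simp only [Real.norm_eq_abs]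
  have key2 : ∀ (ν : Measure (X × X)) (h : X × X → ℝ), Measurable h →
      Integrable (fun x => |h x| ^ p) ν → MemLp h q ν := by
    intro ν h hh hhi
    rw [← integrable_norm_rpow_iff hh.aestronglyMeasurable hq0 hqt, hqr]
    simpa only [Real.norm_eq_abs] using hhi
  have hfpm : Measurable fun x => |f x| ^ p := by fun_prop
  have i1 : ∀ k, ∫ x, |f x| ^ p ∂(μs k) = ∫ z, |f z.1| ^ p ∂(π k) := fun k => by
    rw [← h1 k, integral_map measurable_fst.aemeasurable hfpm.aestronglyMeasurable]
  have i2 : ∀ k, ∫ x, |f x| ^ p ∂μ = ∫ z, |f z.2| ^ p ∂(π k) := fun k => by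
    rw [← h2 k, integral_map measurable_snd.aemeasurable hfpm.aestronglyMeasurable]
  have m1 : ∀ k, MemLp (fun z : X × X => f z.1) q (π k) := fun k =>
    key2 _ _ (hf.comp measurable_fst) (by
      have := hi k
      rw [← h1 k] at this
      exact this.comp_measurable measurable_fst)
  have m2 : ∀ k, MemLp (fun z : X × X => f z.2) q (π k) := fun k =>
    key2 _ _ (hf.comp measurable_snd) (by
      have := hi'
      rw [← h2 k] at this
      exact this.comp_measurable measurable_snd)
  set F : ℕ → ℝ := fun k => (∫ x, |f x| ^ p ∂(μs k)) ^ p⁻¹ with hF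
  set L : ℝ := (∫ x, |f x| ^ p ∂μ) ^ p⁻¹ with hL
  have hdiff : ∀ k, |F k - L| ≤ (∫ z, c z ∂(π k)) ^ p⁻¹ := by
    intro k
    have n1 : lpNorm (fun z : X × X => f z.1) q (π k) = F k := by
      rw [key _ (fun z : X × X => f z.1) (hf.comp measurable_fst), hF]; simp only; rw [i1]
    have n2 : lpNorm (fun z : X × X => f z.2) q (π k) = L := by
      rw [key _ (fun z : X × X => f z.2) (hf.comp measurable_snd), hL, i2 k]
    have n3 : lpNorm ((fun z : X × X => f z.1) - (fun z : X × X => f z.2)) q (π k) ≤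
        (∫ z, c z ∂(π k)) ^ p⁻¹ := by
      rw [key _ ((fun z : X × X => f z.1) - (fun z : X × X => f z.2)) ((hf.comp measurable_fst).sub (hf.comp measurable_snd))]
      refine Real.rpow_le_rpow (integral_nonneg fun z => by positivity) ?_ (by positivity)
      exact integral_mono_of_nonneg (ae_of_all _ fun z => by positivity) (hci k)
        (ae_of_all _ hfc)
    have b1 := lpNorm_le_lpNorm_add_lpNorm_sub' (f := fun z : X × X => f z.1) (m2 k) hq1
    have b2 := lpNorm_le_lpNorm_add_lpNorm_sub (f := fun z : X × X => f z.2) (m1 k) hq1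
    rw [n1, n2] at b1 b2
    rw [abs_le]
    constructor <;> linarith
  have hz : Tendsto (fun k => (∫ z, c z ∂(π k)) ^ p⁻¹) atTop (𝓝 0) := by
    have := hct.rpow_const (p := p⁻¹) (Or.inr (by positivity))
    rwa [Real.zero_rpow (by positivity)] at this
  have hFt : Tendsto F atTop (𝓝 L) := by
    rw [tendsto_iff_dist_tendsto_zero]
    exact squeeze_zero (fun k => dist_nonneg) hdiff hz
  have := hFt.rpow_const (p := p) (Or.inr hp0.le)
  have e : ∀ (ν : Measure X), ((∫ x, |f x| ^ p ∂ν) ^ p⁻¹) ^ p = ∫ x, |f x| ^ p ∂ν := fun ν =>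
    Real.rpow_inv_rpow (integral_nonneg fun z => by positivity) hp0.ne'
  simpa only [hF, hL, e] using this

lemma aux_tight_set {X : Type*} [MetricSpace X] [MeasurableSpace X] [BorelSpace X]
    [SecondCountableTopology X] (p : ℝ) (hp : 1 ≤ p)
    (c : X × X → ℝ) (hc : ∀ z : X × X, dist z.1 z.2 ^ p ≤ c z)
    (μs : ℕ → Measure X) (μ : Measure X) (π : ℕ → Measure (X × X))
    [∀ k, IsProbabilityMeasure (π k)] [∀ k, IsProbabilityMeasure (μs k)] [IsProbabilityMeasure μ]
    (h1 : ∀ k, (π k).map Prod.fst = μs k) (h2 : ∀ k, (π k).map Prod.snd = μ)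
    (hci : ∀ k, Integrable c (π k)) (hct : Tendsto (fun k => ∫ z, c z ∂(π k)) atTop (𝓝 0))
    (φ : BoundedContinuousFunction X ℝ) :
    Tendsto (fun k => ∫ z, φ z ∂(μs k)) atTop (𝓝 (∫ z, φ z ∂μ)) := by
  have hp0 : 0 < p := by linarith
  have hc0 : ∀ z, 0 ≤ c z := fun z => (by positivity : 0 ≤ dist z.1 z.2 ^ p).trans (hc z)
  have H := (tendsto_iff_forall_lipschitz_integral_tendsto (F := atTop)
    (μs := fun k => (⟨μs k, inferInstance⟩ : ProbabilityMeasure X))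
    (μ := (⟨μ, inferInstance⟩ : ProbabilityMeasure X))).2 ?_
  · exact (ProbabilityMeasure.tendsto_iff_forall_integral_tendsto.1 H) φ
  rintro f ⟨B, hB⟩ ⟨L, hL⟩
  change Tendsto (fun k => ∫ z, f z ∂(μs k)) atTop (𝓝 (∫ z, f z ∂μ))
  have hfc := hL.continuous
  obtain ⟨D, hD⟩ : ∃ D, ∀ x, ‖f x‖ ≤ D := by
    rcases isEmpty_or_nonempty X with h | ⟨⟨x0⟩⟩
    · exact ⟨0, fun x => h.elim x⟩
    · refine ⟨‖f x0‖ + B, fun x => ?_⟩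
      have := hB x x0
      rw [dist_eq_norm] at this
      have := norm_le_insert' (f x) (f x0)
      linarith
  have hint : ∀ k, ∫ z, f z ∂(μs k) - ∫ z, f z ∂μ = ∫ z, (f z.1 - f z.2) ∂(π k) := by
    intro k
    rw [integral_sub, ← h1 k, ← h2 k, integral_map measurable_fst.aemeasurable
      hfc.aestronglyMeasurable, integral_map measurable_snd.aemeasurable hfc.aestronglyMeasurable]
    · exact Integrable.of_bound (hfc.comp continuous_fst).aestronglyMeasurable D
        (ae_of_all _ fun z => hD _)
    · exact Integrable.of_bound (hfc.comp continuous_snd).aestronglyMeasurable D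
        (ae_of_all _ fun z => hD _)
  rw [Metric.tendsto_atTop']
  intro ε hε
  obtain ⟨δ, hδ, hδ'⟩ := Metric.uniformContinuous_iff.1 hL.uniformContinuous (ε / 2) (by positivity)
  have hB0 : ∀ k, |∫ z, f z ∂(μs k) - ∫ z, f z ∂μ| ≤ ε / 2 + |B| / δ ^ p * ∫ z, c z ∂(π k) := by
    intro k
    rw [hint k, ← integral_const_mul]
    have e : ∫ z, (ε / 2 + |B| / δ ^ p * c z) ∂(π k) = ε / 2 + ∫ z, |B| / δ ^ p * c z ∂(π k) := by
      rw [integral_add (integrable_const _) ((hci k).const_mul _)]; simp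
    rw [← e]
    refine (abs_integral_le_integral_abs).trans ?_
    refine integral_mono_of_nonneg (ae_of_all _ fun z => abs_nonneg _)
      ((integrable_const _).add ((hci k).const_mul _)) (ae_of_all _ fun z => ?_)
    simp only
    by_cases hd : dist z.1 z.2 < δ
    · have := hδ' hd
      rw [Real.dist_eq] at this
      have : 0 ≤ |B| / δ ^ p * c z := mul_nonneg (by positivity) (hc0 z)
      linarith
    · have h3 := hB z.1 z.2
      rw [Real.dist_eq] at h3
      have h4 : δ ^ p ≤ c z :=
        (Real.rpow_le_rpow hδ.le (not_lt.1 hd) hp0.le).trans (hc z)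
      have h5 : |B| ≤ |B| / δ ^ p * c z := by
        rw [div_mul_eq_mul_div, le_div_iff₀ (by positivity)]
        exact mul_le_mul_of_nonneg_left h4 (abs_nonneg _)
      have := le_abs_self B
      linarith
  have hlim : Tendsto (fun k => ε / 2 + |B| / δ ^ p * ∫ z, c z ∂(π k)) atTop
      (𝓝 (ε / 2 + |B| / δ ^ p * 0)) := (hct.const_mul _).const_add _
  have hev := hlim.eventually (gt_mem_nhds (show ε / 2 + |B| / δ ^ p * 0 < ε by linarith))
  obtain ⟨N, hN⟩ := eventually_atTop.1 hev
  exact ⟨N, fun k hk => by rw [Real.dist_eq]; exact (hB0 k).trans_lt (hN k hk.le)⟩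

/-- The cost `d_p^p`. -/
def aux_cst {d : ℕ} (p : ℝ) (z : Zsp d × Zsp d) : ℝ :=
  (∑ i, |z.1.1 i - z.2.1 i| ^ p) + |z.1.2 - z.2.2| ^ p

lemma aux_cst_nonneg {d : ℕ} (p : ℝ) (z : Zsp d × Zsp d) : 0 ≤ aux_cst p z := by
  unfold aux_cst; positivity

lemma aux_dPmet_pow {d : ℕ} (p : ℝ) (hp : 1 ≤ p) (z z' : Zsp d) :
    dPmet p z z' ^ p = aux_cst p (z, z') := by
  unfold dPmet
  rw [one_div, Real.rpow_inv_rpow (by positivity) (by linarith)]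
  rfl

lemma aux_dpw_pow {d : ℕ} (p w : ℝ) (hp : 1 ≤ p) (hw : w ∈ Set.Icc (0 : ℝ) 1) (z z' : Zsp d) :
    dpw p w z z' ^ p = w * (∑ i, |z.1 i - z'.1 i| ^ p) + (1 - w) * |z.2 - z'.2| ^ p := by
  unfold dpw
  have h1 := hw.1
  have h2 : 0 ≤ 1 - w := by linarith [hw.2]
  rw [one_div, Real.rpow_inv_rpow (by positivity) (by linarith)]

lemma aux_dpw_nonneg {d : ℕ} (p w : ℝ) (hp : 1 ≤ p) (hw : w ∈ Set.Icc (0 : ℝ) 1) (z z' : Zsp d) :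
    0 ≤ dpw p w z z' ^ p := by
  rw [aux_dpw_pow p w hp hw]
  have h1 := hw.1
  have h2 : 0 ≤ 1 - w := by linarith [hw.2]
  positivity

lemma aux_dpw_le {d : ℕ} (p w : ℝ) (hp : 1 ≤ p) (hw : w ∈ Set.Icc (0 : ℝ) 1) (z z' : Zsp d) :
    dpw p w z z' ^ p ≤ aux_cst p (z, z') := by
  rw [aux_dpw_pow p w hp hw]
  unfold aux_cst
  have h1 := hw.1
  have h2 := hw.2
  exact add_le_add (mul_le_of_le_one_left (by positivity) h2)
    (mul_le_of_le_one_left (by positivity) (by linarith))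

lemma aux_dpw_half {d : ℕ} (p : ℝ) (hp : 1 ≤ p) (z z' : Zsp d) :
    dpw p (1 / 2) z z' ^ p = 1 / 2 * aux_cst p (z, z') := by
  rw [aux_dpw_pow p _ hp (by constructor <;> norm_num)]
  unfold aux_cst
  ring

lemma aux_cst_continuous {d : ℕ} (p : ℝ) (hp : 1 ≤ p) :
    Continuous (aux_cst p : Zsp d × Zsp d → ℝ) := by
  unfold aux_cst
  have hp0 : 0 ≤ p := by linarith
  refine Continuous.add (continuous_finsetSum _ fun i _ => ?_) ?_
  · exact Continuous.rpow_const (by fun_prop) fun _ => Or.inr hp0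
  · exact Continuous.rpow_const (by fun_prop) fun _ => Or.inr hp0

lemma aux_cst_self {d : ℕ} (p : ℝ) (hp : 1 ≤ p) (z : Zsp d) : aux_cst p (z, z) = 0 := by
  have hp0 : p ≠ 0 := by linarith
  simp [aux_cst, Real.zero_rpow hp0]

lemma aux_pow_ineq (p : ℝ) (hp : 1 ≤ p) (a b : ℝ) :
    |a - b| ^ p ≤ 2 ^ p * (|0 - a| ^ p + |0 - b| ^ p) := by
  have hp0 : 0 ≤ p := by linarith
  have h1 : |a - b| ≤ 2 * max |a| |b| := by
    have := abs_sub a b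
    have := le_max_left |a| |b|
    have := le_max_right |a| |b|
    linarith
  rw [zero_sub, zero_sub, abs_neg, abs_neg]
  calc |a - b| ^ p ≤ (2 * max |a| |b|) ^ p := Real.rpow_le_rpow (abs_nonneg _) h1 hp0
    _ = 2 ^ p * (max |a| |b|) ^ p := Real.mul_rpow (by norm_num) (by positivity)
    _ ≤ _ := by
      gcongr
      have ha : 0 ≤ |a| ^ p := by positivity
      have hb : 0 ≤ |b| ^ p := by positivity
      rcases max_choice |a| |b| with h | h <;> rw [h] <;> linarith

lemma aux_cst_le {d : ℕ} (p : ℝ) (hp : 1 ≤ p) (x y : Zsp d) :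
    aux_cst p (x, y) ≤ 2 ^ p * (aux_cst p (0, x) + aux_cst p (0, y)) := by
  unfold aux_cst
  have h1 : ∑ i, |x.1 i - y.1 i| ^ p ≤ ∑ i, 2 ^ p * (|0 - x.1 i| ^ p + |0 - y.1 i| ^ p) :=
    Finset.sum_le_sum fun i _ => aux_pow_ineq p hp _ _
  have h2 := aux_pow_ineq p hp x.2 y.2
  rw [← Finset.mul_sum, Finset.sum_add_distrib] at h1
  simp only [Prod.fst_zero, Prod.snd_zero, Pi.zero_apply]
  linarith

lemma aux_coord_le {d : ℕ} (p : ℝ) (i : Fin d) (z : Zsp d × Zsp d) :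
    |z.1.1 i - z.2.1 i| ^ p ≤ aux_cst p z := by
  unfold aux_cst
  have := Finset.single_le_sum (f := fun i => |z.1.1 i - z.2.1 i| ^ p)
    (fun j _ => by positivity) (Finset.mem_univ i)
  have h : 0 ≤ |z.1.2 - z.2.2| ^ p := by positivity
  linarith

lemma aux_coord_le' {d : ℕ} (p : ℝ) (z : Zsp d × Zsp d) :
    |z.1.2 - z.2.2| ^ p ≤ aux_cst p z := by
  unfold aux_cst
  have h : 0 ≤ ∑ i, |z.1.1 i - z.2.1 i| ^ p := by positivity
  linarith

lemma aux_dist_le {d : ℕ} (p : ℝ) (hp : 1 ≤ p) (z : Zsp d × Zsp d) :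
    dist z.1 z.2 ^ p ≤ aux_cst p z := by
  have hp0 : 0 < p := by linarith
  have h0 := aux_cst_nonneg p z
  have hle : dist z.1 z.2 ≤ (aux_cst p z) ^ p⁻¹ := by
    have hco : ∀ t : ℝ, |t| ^ p ≤ aux_cst p z → |t| ≤ (aux_cst p z) ^ p⁻¹ := by
      intro t ht
      exact (Real.le_rpow_inv_iff_of_pos (abs_nonneg _) h0 hp0).2 ht
    rw [Prod.dist_eq]
    refine max_le ((dist_pi_le_iff (by positivity)).2 fun i => ?_) ?_
    · rw [Real.dist_eq]; exact hco _ (aux_coord_le p i z)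
    · rw [Real.dist_eq]; exact hco _ (aux_coord_le' p z)
  exact (Real.le_rpow_inv_iff_of_pos dist_nonneg h0 hp0).1 hle

lemma aux_mem_int {d : ℕ} (p : ℝ) (hp : 1 ≤ p) {μ : Measure (Zsp d)} (hμ : MemPp p μ)
    (z0 : Zsp d) : Integrable (fun z => aux_cst p (z0, z)) μ := by
  have := hμ.2 z0
  simpa only [aux_dPmet_pow p hp] using this

lemma aux_cst_int {d : ℕ} (p : ℝ) (hp : 1 ≤ p) {α β : Measure (Zsp d)} (hα : MemPp p α)
    (hβ : MemPp p β) {π : Measure (Zsp d × Zsp d)} (hπ : IsCoupling π α β) :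
    Integrable (aux_cst p) π := by
  have i1 := aux_mem_int p hp hα 0
  have i2 := aux_mem_int p hp hβ 0
  rw [← hπ.2.1] at i1
  rw [← hπ.2.2] at i2
  have j1 := i1.comp_measurable measurable_fst
  have j2 := i2.comp_measurable measurable_snd
  refine ((j1.add j2).const_mul (2 ^ p)).mono' (aux_cst_continuous p hp).aestronglyMeasurable
    (ae_of_all _ fun z => ?_)
  rw [Real.norm_eq_abs, abs_of_nonneg (aux_cst_nonneg p z)]
  exact aux_cst_le p hp z.1 z.2

lemma aux_prod_coupling {d : ℕ} {α β : Measure (Zsp d)} (hα : IsProbabilityMeasure α)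
    (hβ : IsProbabilityMeasure β) : IsCoupling (α.prod β) α β :=
  ⟨inferInstance, by simp, by simp⟩

lemma aux_Wpw_le {d : ℕ} (p w : ℝ) (hp : 1 ≤ p) (hw : w ∈ Set.Icc (0 : ℝ) 1)
    {α β : Measure (Zsp d)} (hα : MemPp p α)
    (hβ : MemPp p β) {π : Measure (Zsp d × Zsp d)} (hπ : IsCoupling π α β) :
    Wpw p w α β ≤ (∫ z, aux_cst p z ∂π) ^ (1 / p) := by
  unfold Wpw
  have hp0 : 0 < p := by linarith
  refine Real.rpow_le_rpow (Real.sInf_nonneg ?_) ?_ (by positivity)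
  · rintro r ⟨π', -, rfl⟩
    exact integral_nonneg fun z => aux_dpw_nonneg p w hp hw _ _
  · have hbdd : BddBelow {r : ℝ | ∃ π : Measure (Zsp d × Zsp d), IsCoupling π α β ∧
        r = ∫ z, dpw p w z.1 z.2 ^ p ∂π} := by
      refine ⟨0, ?_⟩
      rintro r ⟨π', -, rfl⟩
      exact integral_nonneg fun z => aux_dpw_nonneg p w hp hw _ _
    refine (csInf_le hbdd ⟨π, hπ, rfl⟩).trans ?_
    · exact integral_mono_of_nonneg (ae_of_all _ fun z => aux_dpw_nonneg p w hp hw _ _)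
        (aux_cst_int p hp hα hβ hπ) (ae_of_all _ fun z => aux_dpw_le p w hp hw _ _)

lemma aux_Wpw_nonneg {d : ℕ} (p w : ℝ) (hp : 1 ≤ p) (hw : w ∈ Set.Icc (0 : ℝ) 1)
    (α β : Measure (Zsp d)) : 0 ≤ Wpw p w α β := by
  unfold Wpw
  refine Real.rpow_nonneg (Real.sInf_nonneg ?_) _
  rintro r ⟨π', -, rfl⟩
  exact integral_nonneg fun z => aux_dpw_nonneg p w hp hw _ _

lemma aux_Dp_nonneg {d : ℕ} (p : ℝ) (hp : 1 ≤ p) (α β : Measure (Zsp d)) : 0 ≤ Dp p α β := by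
  unfold Dp
  refine Real.sSup_nonneg ?_
  rintro r ⟨w, hw, rfl⟩
  exact aux_Wpw_nonneg p w hp hw α β

lemma aux_Dp_le {d : ℕ} (p : ℝ) (hp : 1 ≤ p) {α β : Measure (Zsp d)} (hα : MemPp p α)
    (hβ : MemPp p β) {π : Measure (Zsp d × Zsp d)} (hπ : IsCoupling π α β) :
    Dp p α β ≤ (∫ z, aux_cst p z ∂π) ^ (1 / p) := by
  unfold Dp
  have hne : {r : ℝ | ∃ w ∈ Set.Icc (0 : ℝ) 1, r = Wpw p w α β}.Nonempty :=
    ⟨_, 0, ⟨le_rfl, zero_le_one⟩, rfl⟩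
  refine csSup_le hne ?_
  rintro r ⟨w, hw, rfl⟩
  exact aux_Wpw_le p w hp hw hα hβ hπ

lemma aux_le_Dp {d : ℕ} (p w : ℝ) (hp : 1 ≤ p) (hw : w ∈ Set.Icc (0 : ℝ) 1)
    {α β : Measure (Zsp d)} (hα : MemPp p α) (hβ : MemPp p β) :
    Wpw p w α β ≤ Dp p α β := by
  unfold Dp
  refine le_csSup ⟨(∫ z, aux_cst p z ∂(α.prod β)) ^ (1 / p), ?_⟩ ⟨w, hw, rfl⟩
  rintro r ⟨w', hw', rfl⟩
  exact aux_Wpw_le p w' hp hw' hα hβ (aux_prod_coupling hα.1 hβ.1)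

lemma aux_exists_coupling {d : ℕ} (p : ℝ) (hp : 1 ≤ p) {α β : Measure (Zsp d)} (hα : MemPp p α)
    (hβ : MemPp p β) (ε : ℝ) (hε : 0 < ε) :
    ∃ π, IsCoupling π α β ∧ ∫ z, aux_cst p z ∂π ≤ 2 * (Dp p α β ^ p + ε) := by
  have hp0 : 0 < p := by linarith
  have hw : (1 / 2 : ℝ) ∈ Set.Icc (0 : ℝ) 1 := by constructor <;> norm_num
  have hne : {r : ℝ | ∃ π : Measure (Zsp d × Zsp d), IsCoupling π α β ∧
    r = ∫ z, dpw p (1 / 2) z.1 z.2 ^ p ∂π}.Nonempty := ⟨_, _, aux_prod_coupling hα.1 hβ.1, rfl⟩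
  obtain ⟨r, ⟨π, hπ, rfl⟩, hr⟩ := Real.lt_sInf_add_pos hne hε
  refine ⟨π, hπ, ?_⟩
  have h1 := aux_le_Dp p (1 / 2) hp hw hα hβ
  have h2 := Real.rpow_le_rpow (aux_Wpw_nonneg p _ hp hw α β) h1 hp0.le
  unfold Wpw at h2
  rw [one_div p, Real.rpow_inv_rpow (Real.sInf_nonneg (by
    rintro r ⟨π', -, rfl⟩
    exact integral_nonneg fun z => aux_dpw_nonneg p _ hp hw _ _)) hp0.ne'] at h2
  simp_rw [aux_dpw_half p hp] at hr h2
  rw [integral_const_mul] at hr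
  linarith

/-- Weak convergence in `P_p(ℝ^{d+1})` is equivalent to convergence in `D_p`. -/
theorem Dp_metrizes_weak_convergence {d : ℕ} (hd : 1 ≤ d) (p : ℝ) (hp : 1 ≤ p)
    (μs : ℕ → Measure (Zsp d)) (hμs : ∀ k, MemPp p (μs k))
    (μ : Measure (Zsp d)) (hμ : MemPp p μ) :
    WeakConvPp p μs μ ↔ Tendsto (fun k => Dp p (μs k) μ) atTop (𝓝 0) := by
  have hp0 : 0 < p := by linarith
  haveI : ∀ k, IsProbabilityMeasure (μs k) := fun k => (hμs k).1
  haveI : IsProbabilityMeasure μ := hμ.1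
  constructor
  · rintro ⟨hw, hm⟩
    have hm0 := hm 0
    simp_rw [aux_dPmet_pow p hp] at hm0
    rw [Metric.tendsto_atTop']
    intro ε hε
    have hev := aux_forward (aux_cst p : Zsp d × Zsp d → ℝ) (aux_cst_continuous p hp)
      (aux_cst_self p hp) (aux_cst_nonneg p) (fun z => aux_cst p (0, z))
      ((aux_cst_continuous p hp).comp (by fun_prop)) (fun z => aux_cst_nonneg p _) (2 ^ p)
      (by positivity) (aux_cst_le p hp) μs μ (fun k => aux_mem_int p hp (hμs k) 0)
      (aux_mem_int p hp hμ 0) hw hm0 (ε ^ p) (by positivity)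
    obtain ⟨N, hN⟩ := eventually_atTop.1 hev
    refine ⟨N, fun k hk => ?_⟩
    obtain ⟨π, h1, h2, h3, h4⟩ := hN k hk.le
    rw [Real.dist_eq, sub_zero, abs_of_nonneg (aux_Dp_nonneg p hp _ _)]
    refine (aux_Dp_le p hp (hμs k) hμ ⟨h1, h2, h3⟩).trans_lt ?_
    have := Real.rpow_lt_rpow (integral_nonneg (aux_cst_nonneg p)) h4
      (show 0 < 1 / p by positivity)
    rwa [one_div, Real.rpow_rpow_inv hε.le hp0.ne', ← one_div] at this
  · intro hD
    have hex : ∀ k : ℕ, ∃ π, IsCoupling π (μs k) μ ∧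
        ∫ z, aux_cst p z ∂π ≤ 2 * (Dp p (μs k) μ ^ p + 1 / ((k : ℝ) + 1)) := fun k =>
      aux_exists_coupling p hp (hμs k) hμ _ (by positivity)
    choose π hπ hπc using hex
    haveI : ∀ k, IsProbabilityMeasure (π k) := fun k => (hπ k).1
    have hci : ∀ k, Integrable (aux_cst p) (π k) := fun k => aux_cst_int p hp (hμs k) hμ (hπ k)
    have hct : Tendsto (fun k => ∫ z, aux_cst p z ∂(π k)) atTop (𝓝 0) := by
      refine squeeze_zero (fun k => integral_nonneg (aux_cst_nonneg p)) hπc ?_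
      have t1 := hD.rpow_const (p := p) (Or.inr hp0.le)
      rw [Real.zero_rpow hp0.ne'] at t1
      simpa using (t1.add tendsto_one_div_add_atTop_nhds_zero_nat).const_mul 2
    refine ⟨aux_tight_set p hp (aux_cst p) (aux_dist_le p hp) μs μ π (fun k => (hπ k).2.1)
      (fun k => (hπ k).2.2) hci hct, fun z0 => ?_⟩
    simp_rw [aux_dPmet_pow p hp]
    have hcoord : ∀ f : Zsp d → ℝ, Continuous f → (∀ z, |f z| ^ p ≤ aux_cst p (z0, z)) →
        ∀ ν, MemPp p ν → Integrable (fun z => |f z| ^ p) ν := by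
      intro f hf hle ν hν
      refine (aux_mem_int p hp hν z0).mono'
        (hf.abs.rpow_const fun _ => Or.inr hp0.le).aestronglyMeasurable (ae_of_all _ fun z => ?_)
      rw [Real.norm_eq_abs, abs_of_nonneg (by positivity)]
      exact hle z
    have hmom : ∀ f : Zsp d → ℝ, Continuous f → (∀ z, |f z| ^ p ≤ aux_cst p (z0, z)) →
        (∀ z : Zsp d × Zsp d, |f z.1 - f z.2| ^ p ≤ aux_cst p z) →
        Tendsto (fun k => ∫ z, |f z| ^ p ∂(μs k)) atTop (𝓝 (∫ z, |f z| ^ p ∂μ)) := by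
      intro f hf hle hfc
      exact aux_moment p hp f hf.measurable (aux_cst p) hfc μs μ π (fun k => (hπ k).2.1)
        (fun k => (hπ k).2.2) hci hct (fun k => hcoord f hf hle _ (hμs k)) (hcoord f hf hle _ hμ)
    have c1 : ∀ i : Fin d, Continuous fun z : Zsp d => z0.1 i - z.1 i := fun i => by fun_prop
    have c2 : Continuous fun z : Zsp d => z0.2 - z.2 := by fun_prop
    have l1 : ∀ i (z : Zsp d), |z0.1 i - z.1 i| ^ p ≤ aux_cst p (z0, z) := fun i z =>
      aux_coord_le p i (z0, z)
    have l2 : ∀ z : Zsp d, |z0.2 - z.2| ^ p ≤ aux_cst p (z0, z) := fun z =>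
      aux_coord_le' p (z0, z)
    have e : ∀ ν, MemPp p ν → ∫ z, aux_cst p (z0, z) ∂ν =
        (∑ i, ∫ z, |z0.1 i - z.1 i| ^ p ∂ν) + ∫ z, |z0.2 - z.2| ^ p ∂ν := by
      intro ν hν
      unfold aux_cst
      have hI : ∀ i, Integrable (fun z : Zsp d => |z0.1 i - z.1 i| ^ p) ν := fun i =>
        hcoord _ (c1 i) (l1 i) ν hν
      rw [integral_add (integrable_finsetSum _ fun i _ => hI i) (hcoord _ c2 l2 ν hν),
        integral_finsetSum _ fun i _ => hI i]
    rw [e μ hμ]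
    simp_rw [e _ (hμs _)]
    refine Tendsto.add (tendsto_finsetSum _ fun i _ => hmom _ (c1 i) (l1 i) fun z => ?_)
      (hmom _ c2 l2 fun z => ?_)
    · rw [sub_sub_sub_cancel_left, abs_sub_comm]; exact aux_coord_le p i z
    · rw [sub_sub_sub_cancel_left, abs_sub_comm]; exact aux_coord_le' p z
end
end

section
/- For every p ∈ [1,∞), the metric space (P_p(ℝ^{d+1}), D_p) is complete and separable. -/
open MeasureTheory Filter Topology

noncomputable section

open ProbabilityTheory

lemma map_compProd_comap {X Y Z : Type*} [MeasurableSpace X] [MeasurableSpace Y] [MeasurableSpace Z]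
    (ν : Measure X) [IsProbabilityMeasure ν] (κ : Kernel Y Z) [IsMarkovKernel κ] (f : X → Y)
    (hf : Measurable f) :
    (ν ⊗ₘ (κ.comap f hf)).map (Prod.map f id) = (ν.map f) ⊗ₘ κ := by
  have : IsProbabilityMeasure (ν.map f) := Measure.isProbabilityMeasure_map hf.aemeasurable
  ext s hs
  rw [Measure.map_apply (by fun_prop) hs, Measure.compProd_apply (by measurability),
    Measure.compProd_apply hs, lintegral_map (Kernel.measurable_kernel_prodMk_left hs) hf]
  rfl

lemma glue {Z : Type*} [MeasurableSpace Z] [StandardBorelSpace Z] [Nonempty Z]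
    (π ρ : Measure (Z × Z)) [IsProbabilityMeasure π] [IsProbabilityMeasure ρ]
    (h : π.map Prod.snd = ρ.map Prod.fst) :
    ∃ τ : Measure ((Z × Z) × Z), IsProbabilityMeasure τ ∧ τ.map Prod.fst = π ∧
      τ.map (fun x => (x.1.2, x.2)) = ρ := by
  refine ⟨π ⊗ₘ (ρ.condKernel.comap Prod.snd measurable_snd), inferInstance, ?_, ?_⟩
  · exact Measure.fst_compProd _ _
  · have := map_compProd_comap π ρ.condKernel Prod.snd measurable_snd
    rw [h] at this
    exact this.trans (ρ.disintegrate ρ.condKernel)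

lemma chain {Z : Type} [MeasurableSpace Z] [StandardBorelSpace Z] [Nonempty Z]
    (π : ℕ → Measure (Z × Z)) [∀ n, IsProbabilityMeasure (π n)]
    (h : ∀ n, (π n).map Prod.snd = (π (n+1)).map Prod.fst) :
    ∃ P : Measure (ℕ → Z), IsProbabilityMeasure P ∧
      ∀ n, P.map (fun x => (x n, x (n+1))) = π n := by
  let f : (n : ℕ) → ((i : Finset.Iic n) → Z) → Z := fun n x => x ⟨n, by simp⟩
  have hf : ∀ n, Measurable (f n) := fun n => by fun_prop
  let κ : (n : ℕ) → Kernel ((i : Finset.Iic n) → (fun _ : ℕ => Z) i) ((fun _ : ℕ => Z) (n+1)) :=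
    fun n => (π n).condKernel.comap (f n) (hf n)
  have hκ : ∀ n, IsMarkovKernel (κ n) := fun n => by dsimp only [κ]; infer_instance
  let μ₀ := (π 0).map Prod.fst
  have : IsProbabilityMeasure μ₀ := Measure.isProbabilityMeasure_map measurable_fst.aemeasurable
  let P : Measure (ℕ → Z) := Kernel.trajMeasure (X := fun _ => Z) μ₀ κ
  have hP : IsProbabilityMeasure P := by dsimp only [P]; infer_instance
  have key : ∀ n, P.map (fun x => (x n, x (n+1))) = (P.map (fun x => x n)) ⊗ₘ (π n).condKernel := by
    intro n
    have e : P.map (Preorder.frestrictLe n) ⊗ₘ κ n = P.map (fun x => (Preorder.frestrictLe n x, x (n+1))) :=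
      Kernel.map_frestrictLe_trajMeasure_compProd_eq_map_trajMeasure
    have : IsProbabilityMeasure (P.map (Preorder.frestrictLe n)) :=
      Measure.isProbabilityMeasure_map (by fun_prop)
    have e2 := map_compProd_comap (P.map (Preorder.frestrictLe n)) (π n).condKernel (f n) (hf n)
    have e3 : (P.map (Preorder.frestrictLe n)).map (f n) = P.map (fun x => x n) := by
      rw [Measure.map_map (hf n) (by fun_prop)]; rfl
    rw [e3] at e2
    rw [← e2]
    change _ = Measure.map (Prod.map (f n) id) (P.map (Preorder.frestrictLe n) ⊗ₘ κ n)
    rw [e, Measure.map_map (by fun_prop) (by fun_prop)]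
    rfl
  have key2 : ∀ n, P.map (fun x => x n) = (π n).map Prod.fst := by
    intro n
    induction n with
    | zero =>
      have : P.map (Preorder.frestrictLe 0) = μ₀.map (MeasurableEquiv.piUnique (fun i : Finset.Iic 0 => Z)).symm := by
        dsimp only [P]
        rw [Kernel.trajMeasure, Measure.map_comp _ _ (by fun_prop), Kernel.traj_map_frestrictLe,
          Kernel.partialTraj_self, Measure.id_comp]
      have e3 : (P.map (Preorder.frestrictLe 0)).map (f 0) = P.map (fun x => x 0) := by
        rw [Measure.map_map (hf 0) (by fun_prop)]; rfl
      rw [← e3, this, Measure.map_map (hf 0) (by fun_prop)]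
      exact Measure.map_id
    | succ n ih =>
      have := key n
      rw [ih] at this
      have h2 : P.map (fun x => (x n, x (n+1))) = π n := this.trans ((π n).disintegrate _)
      rw [← h n, ← h2, Measure.map_map (by fun_prop) (by fun_prop)]
      rfl
  refine ⟨P, hP, fun n => ?_⟩
  rw [key n, key2 n]
  exact (π n).disintegrate _

def costS {d : ℕ} (p : ℝ) (z z' : Zsp d) : ℝ :=
  (∑ i, |z.1 i - z'.1 i| ^ p) + |z.2 - z'.2| ^ p

lemma costS_nonneg {d : ℕ} (p : ℝ) (z z' : Zsp d) : 0 ≤ costS p z z' := by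
  unfold costS; positivity

lemma dPmet_rpow {d : ℕ} {p : ℝ} (hp : 1 ≤ p) (z z' : Zsp d) :
    dPmet p z z' ^ p = costS p z z' := by
  change (costS p z z' ^ (1/p)) ^ p = _
  rw [← Real.rpow_mul (costS_nonneg p z z'), one_div_mul_cancel (by positivity), Real.rpow_one]

lemma dpw_rpow {d : ℕ} {p w : ℝ} (hp : 1 ≤ p) (hw : w ∈ Set.Icc (0:ℝ) 1) (z z' : Zsp d) :
    dpw p w z z' ^ p = w * (∑ i, |z.1 i - z'.1 i| ^ p) + (1 - w) * |z.2 - z'.2| ^ p := by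
  have h1 := hw.1
  have h2 : 0 ≤ 1 - w := by linarith [hw.2]
  unfold dpw
  rw [← Real.rpow_mul (by positivity), one_div_mul_cancel (by positivity), Real.rpow_one]

lemma dpw_rpow_le {d : ℕ} {p w : ℝ} (hp : 1 ≤ p) (hw : w ∈ Set.Icc (0:ℝ) 1) (z z' : Zsp d) :
    dpw p w z z' ^ p ≤ costS p z z' := by
  rw [dpw_rpow hp hw, costS]
  have h1 : 0 ≤ ∑ i, |z.1 i - z'.1 i| ^ p := by positivity
  have h2 : 0 ≤ |z.2 - z'.2| ^ p := by positivity
  nlinarith [hw.1, hw.2]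

lemma dpw_rpow_nonneg {d : ℕ} {p w : ℝ} (hp : 1 ≤ p) (hw : w ∈ Set.Icc (0:ℝ) 1) (z z' : Zsp d) :
    0 ≤ dpw p w z z' ^ p := by
  rw [dpw_rpow hp hw]
  have h1 := hw.1
  have h2 : 0 ≤ 1 - w := by linarith [hw.2]
  positivity

lemma dpw_half {d : ℕ} {p : ℝ} (hp : 1 ≤ p) (z z' : Zsp d) :
    dpw p (1/2) z z' ^ p = costS p z z' / 2 := by
  rw [dpw_rpow hp (by constructor <;> norm_num), costS]; ring

lemma costS_le {d : ℕ} {p : ℝ} (hp : 1 ≤ p) (z z' : Zsp d) :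
    costS p z z' ≤ (d + 1) * ‖z - z'‖ ^ p := by
  have h1 : ∀ i, |z.1 i - z'.1 i| ^ p ≤ ‖z - z'‖ ^ p := fun i => by
    gcongr
    exact (norm_le_pi_norm (z.1 - z'.1) i).trans (norm_fst_le (z - z'))
  have h2 : |z.2 - z'.2| ^ p ≤ ‖z - z'‖ ^ p := by
    gcongr
    exact norm_snd_le (z - z')
  have h3 := Finset.sum_le_sum (fun i (_ : i ∈ Finset.univ) => h1 i)
  simp at h3
  unfold costS
  linarith

lemma le_costS {d : ℕ} {p : ℝ} (hp : 1 ≤ p) (z z' : Zsp d) :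
    ‖z - z'‖ ^ p ≤ costS p z z' := by
  have key : ‖z - z'‖ ≤ costS p z z' ^ (1/p) := by
    have hc := costS_nonneg p z z'
    have aux : ∀ a : ℝ, 0 ≤ a → a ^ p ≤ costS p z z' → a ≤ costS p z z' ^ (1/p) := by
      intro a ha h
      rw [one_div, Real.le_rpow_inv_iff_of_pos ha hc (by positivity)]
      exact h
    rw [Prod.norm_def]
    refine max_le ?_ ?_
    · refine (pi_norm_le_iff_of_nonneg (by positivity)).2 fun i => aux _ (norm_nonneg _) ?_
      have := Finset.single_le_sum (f := fun i => |z.1 i - z'.1 i| ^ p) (fun i _ => by positivity)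
        (Finset.mem_univ i)
      unfold costS
      have h2 : 0 ≤ |z.2 - z'.2| ^ p := by positivity
      simp only [Prod.fst_sub, Pi.sub_apply, Real.norm_eq_abs]
      linarith
    · refine aux _ (norm_nonneg _) ?_
      unfold costS
      have h1 : 0 ≤ ∑ i, |z.1 i - z'.1 i| ^ p := by positivity
      simp only [Prod.snd_sub, Real.norm_eq_abs]
      linarith
  calc _ ≤ (costS p z z' ^ (1/p)) ^ p := by gcongr
    _ = _ := dPmet_rpow hp z z'

lemma measurable_costS {d : ℕ} (p : ℝ) :
    Measurable (fun x : Zsp d × Zsp d => costS p x.1 x.2) := by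
  unfold costS; fun_prop

/-- membership in terms of MemLp -/
lemma memPp_iff {d : ℕ} {p : ℝ} (hp : 1 ≤ p) (μ : Measure (Zsp d)) :
    MemPp p μ ↔ IsProbabilityMeasure μ ∧ MemLp (fun z => z) (ENNReal.ofReal p) μ := by
  have hq0 : ENNReal.ofReal p ≠ 0 := by simp; linarith
  have hq : (ENNReal.ofReal p).toReal = p := ENNReal.toReal_ofReal (by linarith)
  unfold MemPp
  refine and_congr_right fun hμ => ?_
  simp_rw [dPmet_rpow hp]
  constructor
  · intro h
    rw [← integrable_norm_rpow_iff (by fun_prop) hq0 (by simp), hq]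
    refine (h 0).mono' (measurable_norm.pow_const p).aestronglyMeasurable (ae_of_all _ fun z => ?_)
    have := le_costS hp 0 z
    rw [zero_sub, norm_neg] at this
    rwa [Real.norm_of_nonneg (by positivity)]
  · intro h z0
    have h' : MemLp (fun z => z0 - z) (ENNReal.ofReal p) μ := (memLp_const z0).sub h
    have h2 := (integrable_norm_rpow_iff h'.1 hq0 (by simp)).2 h'
    rw [hq] at h2
    refine (h2.const_mul ((d:ℝ)+1)).mono' ?_ (ae_of_all _ fun z => ?_)
    · exact ((measurable_costS p).comp (measurable_prodMk_left (x := z0))).aestronglyMeasurable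
    · rw [Real.norm_of_nonneg (costS_nonneg _ _ _)]
      exact costS_le hp z0 z

lemma coupling_memLp {d : ℕ} {p : ℝ} (hp : 1 ≤ p) {α β : Measure (Zsp d)}
    (hα : MemPp p α) (hβ : MemPp p β) {π : Measure (Zsp d × Zsp d)} (h : IsCoupling π α β) :
    MemLp (fun z => z.1 - z.2) (ENNReal.ofReal p) π := by
  obtain ⟨_, rfl, rfl⟩ := h
  have h1 := ((memPp_iff hp _).1 hα).2
  have h2 := ((memPp_iff hp _).1 hβ).2
  exact (h1.comp_of_map measurable_fst.aemeasurable).sub (h2.comp_of_map measurable_snd.aemeasurable)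

lemma coupling_int {d : ℕ} {p : ℝ} (hp : 1 ≤ p) {α β : Measure (Zsp d)}
    (hα : MemPp p α) (hβ : MemPp p β) {π : Measure (Zsp d × Zsp d)} (h : IsCoupling π α β) :
    Integrable (fun z => ‖z.1 - z.2‖ ^ p) π := by
  have hq0 : ENNReal.ofReal p ≠ 0 := by simp; linarith
  have hq : (ENNReal.ofReal p).toReal = p := ENNReal.toReal_ofReal (by linarith)
  have := (coupling_memLp hp hα hβ h)
  have h2 := (integrable_norm_rpow_iff this.1 hq0 (by simp)).2 this
  rwa [hq] at h2

lemma coupling_int' {d : ℕ} {p : ℝ} (hp : 1 ≤ p) {α β : Measure (Zsp d)}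
    (hα : MemPp p α) (hβ : MemPp p β) {π : Measure (Zsp d × Zsp d)} (h : IsCoupling π α β) :
    Integrable (fun z => costS p z.1 z.2) π := by
  refine ((coupling_int hp hα hβ h).const_mul ((d:ℝ)+1)).mono' ?_ (ae_of_all _ fun z => ?_)
  · exact (measurable_costS p).aestronglyMeasurable
  · rw [Real.norm_of_nonneg (costS_nonneg _ _ _)]
    exact costS_le hp _ _

lemma coupling_eLpNorm {d : ℕ} {p : ℝ} (hp : 1 ≤ p) {α β : Measure (Zsp d)}
    (hα : MemPp p α) (hβ : MemPp p β) {π : Measure (Zsp d × Zsp d)} (h : IsCoupling π α β) :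
    eLpNorm (fun z => z.1 - z.2) (ENNReal.ofReal p) π =
      ENNReal.ofReal ((∫ z, ‖z.1 - z.2‖ ^ p ∂π) ^ (1/p)) := by
  have hq0 : ENNReal.ofReal p ≠ 0 := by simp; linarith
  have hq : (ENNReal.ofReal p).toReal = p := ENNReal.toReal_ofReal (by linarith)
  have := (coupling_memLp hp hα hβ h).eLpNorm_eq_integral_rpow_norm hq0 (by simp)
  rwa [hq, ← one_div] at this

def Close {d : ℕ} (p r : ℝ) (α β : Measure (Zsp d)) : Prop :=
  ∃ π, IsCoupling π α β ∧ eLpNorm (fun z => z.1 - z.2) (ENNReal.ofReal p) π < ENNReal.ofReal r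

lemma Wpw_bdd {d : ℕ} {p w : ℝ} (hp : 1 ≤ p) (hw : w ∈ Set.Icc (0:ℝ) 1) (α β : Measure (Zsp d)) :
    ∀ r ∈ {r : ℝ | ∃ π : Measure (Zsp d × Zsp d), IsCoupling π α β ∧
    r = ∫ z, dpw p w z.1 z.2 ^ p ∂π}, 0 ≤ r := by
  rintro r ⟨π, hπ, rfl⟩
  exact integral_nonneg fun z => dpw_rpow_nonneg hp hw _ _

lemma Wpw_nonneg {d : ℕ} {p w : ℝ} (hp : 1 ≤ p) (hw : w ∈ Set.Icc (0:ℝ) 1) (α β : Measure (Zsp d)) :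
    0 ≤ Wpw p w α β := Real.rpow_nonneg (Real.sInf_nonneg (Wpw_bdd hp hw α β)) _

lemma Dp_nonneg {d : ℕ} {p : ℝ} (hp : 1 ≤ p) (α β : Measure (Zsp d)) : 0 ≤ Dp p α β := by
  refine Real.sSup_nonneg ?_
  rintro r ⟨w, hw, rfl⟩
  exact Wpw_nonneg hp hw α β

lemma Wpw_le {d : ℕ} {p w : ℝ} (hp : 1 ≤ p) (hw : w ∈ Set.Icc (0:ℝ) 1) {α β : Measure (Zsp d)}
    (hα : MemPp p α) (hβ : MemPp p β) {π : Measure (Zsp d × Zsp d)} (h : IsCoupling π α β) :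
    Wpw p w α β ≤ ((d:ℝ)+1) ^ (1/p) * (∫ z, ‖z.1 - z.2‖ ^ p ∂π) ^ (1/p) := by
  unfold Wpw
  have h0 : 0 ≤ ∫ z, ‖z.1 - z.2‖ ^ p ∂π := integral_nonneg fun z => by positivity
  rw [← Real.mul_rpow (by positivity) h0]
  refine Real.rpow_le_rpow (Real.sInf_nonneg (Wpw_bdd hp hw α β)) ?_ (by positivity)
  refine (csInf_le ⟨0, Wpw_bdd hp hw α β⟩ ⟨π, h, rfl⟩).trans ?_
  rw [← integral_const_mul]
  refine integral_mono_of_nonneg (ae_of_all _ fun z => dpw_rpow_nonneg hp hw _ _)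
    ((coupling_int hp hα hβ h).const_mul _) (ae_of_all _ fun z => ?_)
  exact (dpw_rpow_le hp hw _ _).trans (costS_le hp _ _)

lemma Close.Dp_le {d : ℕ} {p r : ℝ} (hp : 1 ≤ p) {α β : Measure (Zsp d)}
    (hα : MemPp p α) (hβ : MemPp p β) (h : Close p r α β) :
    Dp p α β ≤ ((d:ℝ)+1) ^ (1/p) * r := by
  obtain ⟨π, hπ, h⟩ := h
  rw [coupling_eLpNorm hp hα hβ hπ] at h
  have h := (ENNReal.ofReal_lt_ofReal_iff_of_nonneg (by positivity)).1 h
  refine csSup_le ⟨_, 0, by simp, rfl⟩ ?_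
  rintro r ⟨w, hw, rfl⟩
  refine (Wpw_le hp hw hα hβ hπ).trans ?_
  gcongr

lemma prod_coupling {d : ℕ} {α β : Measure (Zsp d)} [IsProbabilityMeasure α]
    [IsProbabilityMeasure β] : IsCoupling (α.prod β) α β :=
  ⟨inferInstance, Measure.fst_prod, Measure.snd_prod⟩

lemma close_of_Dp_lt {d : ℕ} {p ε : ℝ} (hp : 1 ≤ p) {α β : Measure (Zsp d)}
    (hα : MemPp p α) (hβ : MemPp p β) (h : Dp p α β < ε) :
    Close p (2 ^ (1/p) * ε) α β := by
  have := hα.1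
  have := hβ.1
  have hpp : IsCoupling (α.prod β) α β := prod_coupling
  have hh : (1/2:ℝ) ∈ Set.Icc (0:ℝ) 1 := by constructor <;> norm_num
  have hb : Wpw p (1/2) α β ≤ Dp p α β := by
    refine le_csSup ⟨((d:ℝ)+1) ^ (1/p) * (∫ z, ‖z.1 - z.2‖ ^ p ∂(α.prod β)) ^ (1/p), ?_⟩ ⟨1/2, hh, rfl⟩
    rintro r ⟨w, hw, rfl⟩
    exact Wpw_le hp hw hα hβ hpp
  have hε : 0 < ε := (Dp_nonneg hp α β).trans_lt h
  have h1 := hb.trans_lt h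
  unfold Wpw at h1
  rw [one_div p, Real.rpow_inv_lt_iff_of_pos (Real.sInf_nonneg (Wpw_bdd hp hh α β)) hε.le
    (by positivity)] at h1
  have hne : {r : ℝ | ∃ π : Measure (Zsp d × Zsp d), IsCoupling π α β ∧
      r = ∫ z, dpw p (1/2) z.1 z.2 ^ p ∂π}.Nonempty := ⟨_, _, hpp, rfl⟩
  obtain ⟨_, ⟨π, hπ, rfl⟩, h2⟩ := exists_lt_of_csInf_lt hne h1
  refine ⟨π, hπ, ?_⟩
  rw [coupling_eLpNorm hp hα hβ hπ]
  rw [ENNReal.ofReal_lt_ofReal_iff (by positivity)]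
  simp_rw [dpw_half hp] at h2
  rw [integral_div] at h2
  have h3 : ∫ z, ‖z.1 - z.2‖ ^ p ∂π ≤ ∫ z, costS p z.1 z.2 ∂π :=
    integral_mono (coupling_int hp hα hβ hπ) (coupling_int' hp hα hβ hπ) fun z => le_costS hp _ _
  rw [one_div p, Real.rpow_inv_lt_iff_of_pos (integral_nonneg fun z => by positivity)
    (by positivity) (by positivity), Real.mul_rpow (by positivity) hε.le,
    Real.rpow_inv_rpow (by positivity) (by positivity)]
  linarith

lemma Close.trans {d : ℕ} {p r s : ℝ} (hp : 1 ≤ p) (hr : 0 ≤ r) (hs : 0 ≤ s)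
    {α β γ : Measure (Zsp d)}
    (h1 : Close p r α β) (h2 : Close p s β γ) : Close p (r + s) α γ := by
  obtain ⟨π, ⟨hπ, ha, hb⟩, h1⟩ := h1
  obtain ⟨ρ, ⟨hρ, hb', hc⟩, h2⟩ := h2
  obtain ⟨τ, hτ, e1, e2⟩ := glue π ρ (hb.trans hb'.symm)
  refine ⟨τ.map (fun x => (x.1.1, x.2)), ⟨Measure.isProbabilityMeasure_map (by fun_prop), ?_, ?_⟩, ?_⟩
  · rw [← ha, ← e1, Measure.map_map (by fun_prop) (by fun_prop),
      Measure.map_map (by fun_prop) (by fun_prop)]; rfl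
  · rw [← hc, ← e2, Measure.map_map (by fun_prop) (by fun_prop),
      Measure.map_map (by fun_prop) (by fun_prop)]; rfl
  · rw [← e1, eLpNorm_map_measure (by fun_prop) (by fun_prop)] at h1
    rw [← e2, eLpNorm_map_measure (by fun_prop) (by fun_prop)] at h2
    rw [eLpNorm_map_measure (by fun_prop) (by fun_prop), ENNReal.ofReal_add hr hs]
    refine lt_of_le_of_lt ?_ (ENNReal.add_lt_add h1 h2)
    refine le_trans (le_of_eq ?_) (eLpNorm_add_le (by fun_prop) (by fun_prop) (by simpa using hp))
    congr 1
    ext1 x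
    simp

/-- laws of random variables -/
lemma close_of_rv {d : ℕ} {p r : ℝ} {Ω : Type*} [MeasurableSpace Ω]
    {P : Measure Ω} [IsProbabilityMeasure P] {X Y : Ω → Zsp d} (hX : AEMeasurable X P)
    (hY : AEMeasurable Y P) (h : eLpNorm (X - Y) (ENNReal.ofReal p) P < ENNReal.ofReal r) :
    Close p r (P.map X) (P.map Y) := by
  refine ⟨P.map (fun ω => (X ω, Y ω)), ⟨Measure.isProbabilityMeasure_map (hX.prodMk hY), ?_, ?_⟩, ?_⟩
  · rw [AEMeasurable.map_map_of_aemeasurable (by fun_prop) (hX.prodMk hY)]; rfl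
  · rw [AEMeasurable.map_map_of_aemeasurable (by fun_prop) (hX.prodMk hY)]; rfl
  · rw [eLpNorm_map_measure (by fun_prop) (hX.prodMk hY)]; exact h

lemma memPp_map {d : ℕ} {p : ℝ} (hp : 1 ≤ p) {Ω : Type*} [MeasurableSpace Ω]
    {P : Measure Ω} [IsProbabilityMeasure P] {X : Ω → Zsp d}
    (hX : MemLp X (ENNReal.ofReal p) P) : MemPp p (P.map X) := by
  rw [memPp_iff hp]
  refine ⟨Measure.isProbabilityMeasure_map hX.1.aemeasurable, ?_⟩
  rw [memLp_map_measure_iff (by fun_prop) hX.1.aemeasurable]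
  exact hX

lemma separable_part {d : ℕ} {p : ℝ} (hp : 1 ≤ p) :
    ∃ S : Set (Measure (Zsp d)), S.Countable ∧ (∀ ν ∈ S, MemPp p ν) ∧
      ∀ μ : Measure (Zsp d), MemPp p μ → ∀ ε : ℝ, 0 < ε → ∃ ν ∈ S, Dp p μ ν < ε := by
  have : Fact (1 ≤ ENNReal.ofReal p) := ⟨by simpa using hp⟩
  have : Fact (ENNReal.ofReal p ≠ ⊤) := ⟨by simp⟩
  obtain ⟨T, hT, hd⟩ := TopologicalSpace.exists_countable_dense
    (Lp (Zsp d) (ENNReal.ofReal p) (volume : Measure unitInterval))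
  refine ⟨(fun f : Lp (Zsp d) (ENNReal.ofReal p) (volume : Measure unitInterval) =>
    (volume : Measure unitInterval).map f) '' T, hT.image _, ?_, ?_⟩
  · rintro _ ⟨f, -, rfl⟩
    exact memPp_map hp (Lp.memLp f)
  · intro μ hμ ε hε
    have := hμ.1
    obtain ⟨f, hf, rfl⟩ := μ.exists_measurable_map_eq
    have hf' : MemLp f (ENNReal.ofReal p) volume :=
      ((memPp_iff hp _).1 hμ).2.comp_of_map hf.aemeasurable
    let C : ℝ := ((d:ℝ)+1) ^ (1/p)
    have hC : 0 < C := by positivity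
    obtain ⟨g, hg, hdist⟩ := hd.exists_dist_lt (hf'.toLp f) (ε := ε / (2*C)) (by positivity)
    refine ⟨_, ⟨g, hg, rfl⟩, ?_⟩
    have hc : Close p (ε / (2*C)) (volume.map f) (volume.map g) := by
      refine close_of_rv hf.aemeasurable (Lp.memLp g).1.aemeasurable ?_
      rw [← edist_lt_ofReal, Lp.edist_def] at hdist
      refine lt_of_eq_of_lt (eLpNorm_congr_ae ?_) hdist
      exact (hf'.coeFn_toLp.symm).sub (ae_eq_refl _)
    refine (hc.Dp_le hp hμ (memPp_map hp (Lp.memLp g))).trans_lt ?_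
    change C * (ε / (2*C)) < ε
    field_simp
    linarith

lemma complete_part {d : ℕ} {p : ℝ} (hp : 1 ≤ p) (μs : ℕ → Measure (Zsp d))
    (hμ : ∀ k, MemPp p (μs k))
    (hc : ∀ ε : ℝ, 0 < ε → ∃ N : ℕ, ∀ j ≥ N, ∀ k ≥ N, Dp p (μs j) (μs k) < ε) :
      ∃ μ : Measure (Zsp d), MemPp p μ ∧
        Tendsto (fun k => Dp p (μs k) μ) atTop (𝓝 0) := by
  have : Fact (1 ≤ ENNReal.ofReal p) := ⟨by simpa using hp⟩
  have hc' : ∀ ε : ℝ, 0 < ε → ∃ N : ℕ, ∀ j ≥ N, ∀ k ≥ N, Close p ε (μs j) (μs k) := by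
    intro ε hε
    obtain ⟨N, hN⟩ := hc (ε / 2 ^ (1/p)) (by positivity)
    refine ⟨N, fun j hj k hk => ?_⟩
    have := close_of_Dp_lt hp (hμ j) (hμ k) (hN j hj k hk)
    rwa [mul_div_cancel₀ _ (by positivity)] at this
  choose N hN using fun n : ℕ => hc' ((1/2)^n) (by positivity)
  let M : ℕ → ℕ := fun n => ∑ i ∈ Finset.range (n+1), N i
  have hM1 : ∀ n, N n ≤ M n := fun n =>
    Finset.single_le_sum (f := N) (fun _ _ => Nat.zero_le _) (by simp)
  have hM2 : ∀ n, N n ≤ M (n+1) := fun n =>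
    Finset.single_le_sum (f := N) (fun _ _ => Nat.zero_le _) (by simp)
  choose π hπ hπ2 using fun n => hN n (M n) (hM1 n) (M (n+1)) (hM2 n)
  have := fun n => (hπ n).1
  obtain ⟨P, hP, hPπ⟩ := chain π (fun n => (hπ n).2.2.trans (hπ (n+1)).2.1.symm)
  have hlaw : ∀ n, P.map (fun x => x n) = μs (M n) := fun n => by
    rw [← (hπ n).2.1, ← hPπ n, Measure.map_map (by fun_prop) (by fun_prop)]; rfl
  have hmem : ∀ n, MemLp (fun x : ℕ → Zsp d => x n) (ENNReal.ofReal p) P := fun n => by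
    have := ((memPp_iff hp _).1 (hμ (M n))).2
    rw [← hlaw n] at this
    exact this.comp_of_map (measurable_pi_apply n).aemeasurable
  let F : ℕ → Lp (Zsp d) (ENNReal.ofReal p) P := fun n => (hmem n).toLp _
  have hF : CauchySeq F := by
    refine cauchySeq_of_le_geometric (1/2) 1 (by norm_num) fun n => ?_
    rw [one_mul]
    refine le_of_lt ?_
    rw [← edist_lt_ofReal, Lp.edist_toLp_toLp]
    have := hπ2 n
    rw [← hPπ n, eLpNorm_map_measure (by fun_prop) (by fun_prop)] at this
    exact this
  obtain ⟨f, hf⟩ := cauchySeq_tendsto_of_complete hF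
  have hfm := Lp.memLp f
  refine ⟨P.map f, memPp_map hp hfm, ?_⟩
  have hlim : ∀ ε : ℝ, 0 < ε → ∃ N : ℕ, ∀ k ≥ N, Close p ε (μs k) (P.map f) := by
    intro ε hε
    obtain ⟨n0, hn0⟩ := Metric.tendsto_atTop.1 hf (ε/2) (by positivity)
    obtain ⟨m, hm⟩ := exists_pow_lt_of_lt_one (show 0 < ε/2 by positivity) (show (1/2:ℝ) < 1 by norm_num)
    let n := max n0 m
    have h1 : Close p (ε/2) (μs (M n)) (P.map f) := by
      rw [← hlaw n]
      refine close_of_rv (measurable_pi_apply n).aemeasurable hfm.1.aemeasurable ?_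
      have hdist := hn0 n (le_max_left _ _)
      rw [← edist_lt_ofReal, Lp.edist_def] at hdist
      refine lt_of_eq_of_lt (eLpNorm_congr_ae ?_) hdist
      exact ((hmem n).coeFn_toLp.symm).sub (ae_eq_refl _)
    refine ⟨N n, fun k hk => ?_⟩
    have h2 := hN n k hk (M n) (hM1 n)
    have h3 : Close p (ε/2) (μs k) (μs (M n)) := by
      obtain ⟨ρ, a, b⟩ := h2
      refine ⟨ρ, a, b.trans_le (ENNReal.ofReal_le_ofReal (le_trans ?_ hm.le))⟩
      exact pow_le_pow_of_le_one (by norm_num) (by norm_num) (le_max_right _ _)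
    have := h3.trans hp (by positivity) (by positivity) h1
    rwa [add_halves] at this
  rw [Metric.tendsto_atTop]
  intro ε hε
  let C : ℝ := ((d:ℝ)+1) ^ (1/p)
  have hC : 0 < C := by positivity
  obtain ⟨N, hN⟩ := hlim (ε / (2*C)) (by positivity)
  refine ⟨N, fun k hk => ?_⟩
  rw [Real.dist_eq, sub_zero, abs_of_nonneg (Dp_nonneg hp _ _)]
  refine ((hN k hk).Dp_le hp (hμ k) (memPp_map hp hfm)).trans_lt ?_
  change C * (ε / (2*C)) < ε
  field_simp
  linarith

/-- `(P_p(ℝ^{d+1}), D_p)` is a complete separable metric space: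
every `D_p`-Cauchy sequence in `P_p` converges in `D_p` to an element of `P_p`, and
there is a countable `D_p`-dense subset of `P_p`. -/
theorem Dp_complete_separable {d : ℕ} (hd : 1 ≤ d) (p : ℝ) (hp : 1 ≤ p) :
    (∀ μs : ℕ → Measure (Zsp d), (∀ k, MemPp p (μs k)) →
      (∀ ε : ℝ, 0 < ε → ∃ N : ℕ, ∀ j ≥ N, ∀ k ≥ N, Dp p (μs j) (μs k) < ε) →
      ∃ μ : Measure (Zsp d), MemPp p μ ∧
        Tendsto (fun k => Dp p (μs k) μ) atTop (𝓝 0)) ∧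
    (∃ S : Set (Measure (Zsp d)), S.Countable ∧ (∀ ν ∈ S, MemPp p ν) ∧
      ∀ μ : Measure (Zsp d), MemPp p μ → ∀ ε : ℝ, 0 < ε → ∃ ν ∈ S, Dp p μ ν < ε) := by
  exact ⟨fun μs hμ hc => complete_part hp μs hμ hc, separable_part hp⟩
end
end

section
/- Let S̃ denote the set of optimal solutions of the dual entropic TiOT minimization problem min{F(u,v,w) : u ∈ ℝ^m, a^⊤u = 0, v ∈ ℝ^n, w ∈ [0,1]}, and let (ξ^k)_{k≥0} = (u^k, v^k, w^k)_{k≥0} be the iterates of the HBCD scheme with stepsize η = (ε/‖C̃‖_∞²) · exp(−6‖C‖_∞/ε). Then ξ^k converges to S̃ in the sense that lim_{k→∞} inf_{ξ ∈ S̃} ‖ξ^k − ξ‖_2 = 0. -/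
open Finset Filter Topology

noncomputable section

/-- Cost matrix `C(w)_{ij} = w‖x_i − y_j‖_p^p + (1−w)|t_i − s_j|^p`. -/
def costM {d m n : ℕ} (p : ℝ) (x : Fin m → Fin d → ℝ) (t : Fin m → ℝ)
    (y : Fin n → Fin d → ℝ) (s : Fin n → ℝ) (w : ℝ) : Matrix (Fin m) (Fin n) ℝ :=
  fun i j => w * (∑ l, |x i l - y j l| ^ p) + (1 - w) * |t i - s j| ^ p

/-- The transport polytope `Π(a,b)`. -/
def transportPolytope {m n : ℕ} (a : Fin m → ℝ) (b : Fin n → ℝ) :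
    Set (Matrix (Fin m) (Fin n) ℝ) :=
  {π | (∀ i j, 0 ≤ π i j) ∧ (∀ i, ∑ j, π i j = a i) ∧ (∀ j, ∑ i, π i j = b j)}

/-- Frobenius pairing `⟨C, π⟩ = Σ_{i,j} C_{ij} π_{ij}`. -/
def ip {m n : ℕ} (C π : Matrix (Fin m) (Fin n) ℝ) : ℝ := ∑ i, ∑ j, C i j * π i j

/-- `KL(π | γ) = Σ_{i,j} (π_{ij} log(π_{ij}/γ_{ij}) − π_{ij} + γ_{ij})` (with `0 log 0 = 0`). -/
def KLdiv {m n : ℕ} (π γ : Matrix (Fin m) (Fin n) ℝ) : ℝ :=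
  ∑ i, ∑ j, (π i j * Real.log (π i j / γ i j) - π i j + γ i j)

/-- `C̃_{ij} = ‖x_i − y_j‖_p^p − |t_i − s_j|^p`. -/
def tildeC {d m n : ℕ} (p : ℝ) (x : Fin m → Fin d → ℝ) (t : Fin m → ℝ)
    (y : Fin n → Fin d → ℝ) (s : Fin n → ℝ) : Matrix (Fin m) (Fin n) ℝ :=
  fun i j => (∑ l, |x i l - y j l| ^ p) - |t i - s j| ^ p

/-- Entrywise sup norm of a matrix. -/
def matSup {m n : ℕ} (C : Matrix (Fin m) (Fin n) ℝ) : ℝ := ⨆ i, ⨆ j, |C i j|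

/-- `‖C‖_∞ = max{‖C(0)‖_∞, ‖C(1)‖_∞}`. -/
def CsupNorm {d m n : ℕ} (p : ℝ) (x : Fin m → Fin d → ℝ) (t : Fin m → ℝ)
    (y : Fin n → Fin d → ℝ) (s : Fin n → ℝ) : ℝ :=
  max (matSup (costM p x t y s 0)) (matSup (costM p x t y s 1))

/-- The dual entropic TiOT objective
`F(u,v,w) = −u^⊤a − v^⊤b + ε Σ_{i,j} exp((u_i + v_j − C(w)_{ij})/ε) a_i b_j − ε`. -/
def Fobj {d m n : ℕ} (p ε : ℝ) (a : Fin m → ℝ) (b : Fin n → ℝ)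
    (x : Fin m → Fin d → ℝ) (t : Fin m → ℝ) (y : Fin n → Fin d → ℝ) (s : Fin n → ℝ)
    (u : Fin m → ℝ) (v : Fin n → ℝ) (w : ℝ) : ℝ :=
  -(∑ i, u i * a i) - (∑ j, v j * b j) +
    ε * (∑ i, ∑ j, Real.exp ((u i + v j - costM p x t y s w i j) / ε) * (a i * b j)) - ε

/-- `∇_w F(u,v,w) = −Σ_{i,j} C̃_{ij} exp((u_i + v_j − C(w)_{ij})/ε) a_i b_j`. -/
def gradW {d m n : ℕ} (p ε : ℝ) (a : Fin m → ℝ) (b : Fin n → ℝ)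
    (x : Fin m → Fin d → ℝ) (t : Fin m → ℝ) (y : Fin n → Fin d → ℝ) (s : Fin n → ℝ)
    (u : Fin m → ℝ) (v : Fin n → ℝ) (w : ℝ) : ℝ :=
  -(∑ i, ∑ j, tildeC p x t y s i j *
      Real.exp ((u i + v j - costM p x t y s w i j) / ε) * (a i * b j))

/-- The HBCD iteration with stepsize `η`: exact minimization in the `u` and `v` blocks
(with the normalization `a^⊤ u^{k+1} = 0`), and one projected gradient step in `w`. -/
def HBCDseq {d m n : ℕ} (p ε η : ℝ) (a : Fin m → ℝ) (b : Fin n → ℝ)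
    (x : Fin m → Fin d → ℝ) (t : Fin m → ℝ) (y : Fin n → Fin d → ℝ) (s : Fin n → ℝ)
    (u : ℕ → Fin m → ℝ) (v : ℕ → Fin n → ℝ) (w : ℕ → ℝ) : Prop :=
  ∀ k : ℕ,
    u (k + 1) = (fun i =>
      -ε * Real.log (∑ j, Real.exp (-costM p x t y s (w k) i j / ε) *
          (Real.exp (v k j / ε) * b j)) +
        ε * ∑ i', a i' * Real.log (∑ j, Real.exp (-costM p x t y s (w k) i' j / ε) *
          (Real.exp (v k j / ε) * b j))) ∧
    v (k + 1) = (fun j =>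
      -ε * Real.log (∑ i, Real.exp (-costM p x t y s (w k) i j / ε) *
          (Real.exp (u (k + 1) i / ε) * a i))) ∧
    w (k + 1) = min 1 (max 0
      (w k - η * gradW p ε a b x t y s (u (k + 1)) (v (k + 1)) (w k)))

/-- The feasible set `{(u,v,w) : a^⊤u = 0, w ∈ [0,1]}` of the dual entropic TiOT problem. -/
def feasSet {m n : ℕ} (a : Fin m → ℝ) : Set ((Fin m → ℝ) × (Fin n → ℝ) × ℝ) :=
  {ζ | (∑ i, a i * ζ.1 i) = 0 ∧ ζ.2.2 ∈ Set.Icc (0 : ℝ) 1}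

/-- The set `S̃` of optimal solutions of the dual entropic TiOT minimization problem. -/
def optSet {d m n : ℕ} (p ε : ℝ) (a : Fin m → ℝ) (b : Fin n → ℝ)
    (x : Fin m → Fin d → ℝ) (t : Fin m → ℝ) (y : Fin n → Fin d → ℝ) (s : Fin n → ℝ) :
    Set ((Fin m → ℝ) × (Fin n → ℝ) × ℝ) :=
  {ζ | ζ ∈ feasSet a ∧ ∀ ζ' ∈ feasSet (n := n) a,
    Fobj p ε a b x t y s ζ.1 ζ.2.1 ζ.2.2 ≤ Fobj p ε a b x t y s ζ'.1 ζ'.2.1 ζ'.2.2}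

/-- The optimal value `F*` of the dual entropic TiOT problem. -/
def Fstar {d m n : ℕ} (p ε : ℝ) (a : Fin m → ℝ) (b : Fin n → ℝ)
    (x : Fin m → Fin d → ℝ) (t : Fin m → ℝ) (y : Fin n → Fin d → ℝ) (s : Fin n → ℝ) : ℝ :=
  sInf {r : ℝ | ∃ ζ : (Fin m → ℝ) × (Fin n → ℝ) × ℝ, ζ ∈ feasSet a ∧
    r = Fobj p ε a b x t y s ζ.1 ζ.2.1 ζ.2.2}

/-- Euclidean (`ℓ²`) distance on `(Fin m → ℝ) × (Fin n → ℝ) × ℝ`. -/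
def dist2 {m n : ℕ} (ζ ζ' : (Fin m → ℝ) × (Fin n → ℝ) × ℝ) : ℝ :=
  Real.sqrt ((∑ i, (ζ.1 i - ζ'.1 i) ^ 2) + (∑ j, (ζ.2.1 j - ζ'.2.1 j) ^ 2) +
    (ζ.2.2 - ζ'.2.2) ^ 2)

namespace HBCDAux

section

variable {m n : ℕ}

/-- Gibbs plan. -/
def P (ε : ℝ) (a : Fin m → ℝ) (b : Fin n → ℝ) (c : ℝ → Matrix (Fin m) (Fin n) ℝ)
    (u : Fin m → ℝ) (v : Fin n → ℝ) (w : ℝ) (i : Fin m) (j : Fin n) : ℝ :=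
  Real.exp ((u i + v j - c w i j) / ε) * (a i * b j)

/-- Abstract objective. -/
def F (ε : ℝ) (a : Fin m → ℝ) (b : Fin n → ℝ) (c : ℝ → Matrix (Fin m) (Fin n) ℝ)
    (u : Fin m → ℝ) (v : Fin n → ℝ) (w : ℝ) : ℝ :=
  -(∑ i, u i * a i) - (∑ j, v j * b j) +
    ε * (∑ i, ∑ j, Real.exp ((u i + v j - c w i j) / ε) * (a i * b j)) - ε

/-- Abstract gradient in `w`. -/
def G (ε : ℝ) (a : Fin m → ℝ) (b : Fin n → ℝ) (B : Matrix (Fin m) (Fin n) ℝ)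
    (c : ℝ → Matrix (Fin m) (Fin n) ℝ)
    (u : Fin m → ℝ) (v : Fin n → ℝ) (w : ℝ) : ℝ :=
  -(∑ i, ∑ j, B i j * Real.exp ((u i + v j - c w i j) / ε) * (a i * b j))

/-- Row scaling sums. -/
def Su (ε : ℝ) (b : Fin n → ℝ) (c : ℝ → Matrix (Fin m) (Fin n) ℝ)
    (v : Fin n → ℝ) (w : ℝ) (i : Fin m) : ℝ :=
  ∑ j, Real.exp (-c w i j / ε) * (Real.exp (v j / ε) * b j)

/-- Column scaling sums. -/
def Sv (ε : ℝ) (a : Fin m → ℝ) (c : ℝ → Matrix (Fin m) (Fin n) ℝ)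
    (u : Fin m → ℝ) (w : ℝ) (j : Fin n) : ℝ :=
  ∑ i, Real.exp (-c w i j / ε) * (Real.exp (u i / ε) * a i)

/-- The `u` update. -/
def Tu (ε : ℝ) (a : Fin m → ℝ) (b : Fin n → ℝ) (c : ℝ → Matrix (Fin m) (Fin n) ℝ)
    (v : Fin n → ℝ) (w : ℝ) (i : Fin m) : ℝ :=
  -ε * Real.log (Su ε b c v w i) + ε * ∑ l, a l * Real.log (Su ε b c v w l)

/-- The `v` update. -/
def Tv (ε : ℝ) (a : Fin m → ℝ) (c : ℝ → Matrix (Fin m) (Fin n) ℝ)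
    (u : Fin m → ℝ) (w : ℝ) (j : Fin n) : ℝ :=
  -ε * Real.log (Sv ε a c u w j)

/-- Projection on `[0,1]`. -/
def proj (r : ℝ) : ℝ := min 1 (max 0 r)

lemma proj_mem (r : ℝ) : proj r ∈ Set.Icc (0 : ℝ) 1 := by
  unfold proj
  constructor
  · exact le_min zero_le_one (le_max_left _ _)
  · exact min_le_left _ _

lemma proj_var (r z : ℝ) (hz : z ∈ Set.Icc (0 : ℝ) 1) :
    0 ≤ (proj r - r) * (z - proj r) := by
  obtain ⟨h0, h1⟩ := hz
  unfold proj
  rcases le_total r 0 with h | h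
  · rw [max_eq_left h, min_eq_right zero_le_one]
    nlinarith
  · rw [max_eq_right h]
    rcases le_total 1 r with h' | h'
    · rw [min_eq_left h']; nlinarith
    · rw [min_eq_right h']; simp

lemma proj_self (z : ℝ) (hz : z ∈ Set.Icc (0 : ℝ) 1) : proj z = z := by
  unfold proj
  rw [max_eq_right hz.1, min_eq_right hz.2]

variable {ε : ℝ} {a : Fin m → ℝ} {b : Fin n → ℝ} {c : ℝ → Matrix (Fin m) (Fin n) ℝ}
  {B : Matrix (Fin m) (Fin n) ℝ}

/-- exponent difference -/
def H (ε : ℝ) (c : ℝ → Matrix (Fin m) (Fin n) ℝ)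
    (u : Fin m → ℝ) (v : Fin n → ℝ) (w : ℝ) (u' : Fin m → ℝ) (v' : Fin n → ℝ) (w' : ℝ)
    (i : Fin m) (j : Fin n) : ℝ :=
  (u' i + v' j - c w' i j) / ε - (u i + v j - c w i j) / ε

/-- Bregman remainder -/
def R (ε : ℝ) (a : Fin m → ℝ) (b : Fin n → ℝ) (c : ℝ → Matrix (Fin m) (Fin n) ℝ)
    (u : Fin m → ℝ) (v : Fin n → ℝ) (w : ℝ) (u' : Fin m → ℝ) (v' : Fin n → ℝ) (w' : ℝ) : ℝ :=
  ε * ∑ i, ∑ j, P ε a b c u v w i j *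
    (Real.exp (H ε c u v w u' v' w' i j) - 1 - H ε c u v w u' v' w' i j)

lemma F_expand (hε : 0 < ε) (hc : ∀ w w' i j, c w' i j = c w i j + (w' - w) * B i j)
    (u : Fin m → ℝ) (v : Fin n → ℝ) (w : ℝ) (u' : Fin m → ℝ) (v' : Fin n → ℝ) (w' : ℝ) :
    F ε a b c u' v' w' - F ε a b c u v w = R ε a b c u v w u' v' w'
      + ∑ i, ((∑ j, P ε a b c u v w i j) - a i) * (u' i - u i)
      + ∑ j, ((∑ i, P ε a b c u v w i j) - b j) * (v' j - v j)
      + G ε a b B c u v w * (w' - w) := by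
  have key : ∀ i j, ε * (P ε a b c u v w i j *
      (Real.exp (H ε c u v w u' v' w' i j) - 1 - H ε c u v w u' v' w' i j))
      = ε * (Real.exp ((u' i + v' j - c w' i j) / ε) * (a i * b j))
        - ε * (Real.exp ((u i + v j - c w i j) / ε) * (a i * b j))
        - P ε a b c u v w i j * (u' i - u i) - P ε a b c u v w i j * (v' j - v j)
        + B i j * Real.exp ((u i + v j - c w i j) / ε) * (a i * b j) * (w' - w) := by
    intro i j
    have h1 : Real.exp ((u' i + v' j - c w' i j) / ε)
        = Real.exp ((u i + v j - c w i j) / ε) * Real.exp (H ε c u v w u' v' w' i j) := by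
      rw [← Real.exp_add]; congr 1; unfold H; ring
    have h2 : ε * H ε c u v w u' v' w' i j
        = (u' i - u i) + (v' j - v j) - (w' - w) * B i j := by
      unfold H; rw [hc w w' i j]; field_simp; ring
    rw [h1]
    unfold P
    linear_combination (-(Real.exp ((u i + v j - c w i j) / ε) * (a i * b j))) * h2
  have hR : R ε a b c u v w u' v' w' =
      ε * (∑ i, ∑ j, Real.exp ((u' i + v' j - c w' i j) / ε) * (a i * b j))
      - ε * (∑ i, ∑ j, Real.exp ((u i + v j - c w i j) / ε) * (a i * b j))
      - (∑ i, (∑ j, P ε a b c u v w i j) * (u' i - u i))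
      - (∑ j, (∑ i, P ε a b c u v w i j) * (v' j - v j))
      - G ε a b B c u v w * (w' - w) := by
    have hcm : (∑ j, (∑ i, P ε a b c u v w i j) * (v' j - v j))
        = ∑ i, ∑ j, P ε a b c u v w i j * (v' j - v j) := by
      rw [Finset.sum_comm]; simp only [Finset.sum_mul]
    rw [hcm]
    unfold R G
    simp only [Finset.mul_sum, Finset.sum_mul, neg_mul, sub_neg_eq_add]
    simp only [key]
    simp only [Finset.sum_add_distrib, Finset.sum_sub_distrib]
  rw [hR]
  unfold F
  simp only [sub_mul, mul_sub, Finset.sum_sub_distrib]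
  have e1 : ∑ i, a i * u' i = ∑ i, u' i * a i := Finset.sum_congr rfl fun i _ => mul_comm _ _
  have e2 : ∑ i, a i * u i = ∑ i, u i * a i := Finset.sum_congr rfl fun i _ => mul_comm _ _
  have e3 : ∑ i, b i * v' i = ∑ i, v' i * b i := Finset.sum_congr rfl fun i _ => mul_comm _ _
  have e4 : ∑ i, b i * v i = ∑ i, v i * b i := Finset.sum_congr rfl fun i _ => mul_comm _ _
  rw [e1, e2, e3, e4]
  ring

lemma P_pos (ha : ∀ i, 0 < a i) (hb : ∀ j, 0 < b j)
    (u : Fin m → ℝ) (v : Fin n → ℝ) (w : ℝ) (i : Fin m) (j : Fin n) :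
    0 < P ε a b c u v w i j :=
  mul_pos (Real.exp_pos _) (mul_pos (ha i) (hb j))

lemma exp_rem_nonneg (h : ℝ) : 0 ≤ Real.exp h - 1 - h := by
  linarith [Real.add_one_le_exp h]

lemma R_nonneg (hε : 0 < ε) (ha : ∀ i, 0 < a i) (hb : ∀ j, 0 < b j)
    (u : Fin m → ℝ) (v : Fin n → ℝ) (w : ℝ) (u' : Fin m → ℝ) (v' : Fin n → ℝ) (w' : ℝ) :
    0 ≤ R ε a b c u v w u' v' w' :=
  mul_nonneg hε.le (Finset.sum_nonneg fun i _ => Finset.sum_nonneg fun j _ =>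
    mul_nonneg (P_pos ha hb u v w i j).le (exp_rem_nonneg _))

lemma R_zero (hε : 0 < ε) (ha : ∀ i, 0 < a i) (hb : ∀ j, 0 < b j)
    (u : Fin m → ℝ) (v : Fin n → ℝ) (w : ℝ) (u' : Fin m → ℝ) (v' : Fin n → ℝ) (w' : ℝ)
    (h : R ε a b c u v w u' v' w' = 0) (i : Fin m) (j : Fin n) :
    u' i + v' j - c w' i j = u i + v j - c w i j := by
  unfold R at h
  have h1 := (mul_eq_zero.1 h).resolve_left hε.ne'
  have nn : ∀ i j, 0 ≤ P ε a b c u v w i j *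
    (Real.exp (H ε c u v w u' v' w' i j) - 1 - H ε c u v w u' v' w' i j) := fun i j =>
    mul_nonneg (P_pos ha hb u v w i j).le (exp_rem_nonneg _)
  have h2 := (Finset.sum_eq_zero_iff_of_nonneg
    (fun i _ => Finset.sum_nonneg fun j _ => nn i j)).1 h1 i (Finset.mem_univ i)
  have h3 := (Finset.sum_eq_zero_iff_of_nonneg (fun j _ => nn i j)).1 h2 j (Finset.mem_univ j)
  have h4 := (mul_eq_zero.1 h3).resolve_left (P_pos ha hb u v w i j).ne'
  have h5 : H ε c u v w u' v' w' i j = 0 := by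
    by_contra hne
    linarith [Real.add_one_lt_exp hne]
  unfold H at h5
  have := sub_eq_zero.1 h5
  exact (div_left_inj' hε.ne').1 this

lemma Su_pos (hn : 1 ≤ n) (hb : ∀ j, 0 < b j) (v : Fin n → ℝ) (w : ℝ) (i : Fin m) :
    0 < Su ε b c v w i := by
  have : Nonempty (Fin n) := ⟨⟨0, hn⟩⟩
  exact Finset.sum_pos (fun j _ => mul_pos (Real.exp_pos _) (mul_pos (Real.exp_pos _) (hb j)))
    Finset.univ_nonempty

lemma Sv_pos (hm : 1 ≤ m) (ha : ∀ i, 0 < a i) (u : Fin m → ℝ) (w : ℝ) (j : Fin n) :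
    0 < Sv ε a c u w j := by
  have : Nonempty (Fin m) := ⟨⟨0, hm⟩⟩
  exact Finset.sum_pos (fun j _ => mul_pos (Real.exp_pos _) (mul_pos (Real.exp_pos _) (ha j)))
    Finset.univ_nonempty

lemma Tu_feas (ha1 : ∑ i, a i = 1) (v : Fin n → ℝ) (w : ℝ) :
    ∑ i, a i * Tu ε a b c v w i = 0 := by
  unfold Tu
  simp only [mul_add, Finset.sum_add_distrib]
  rw [← Finset.sum_mul, ha1, Finset.mul_sum, one_mul, ← Finset.sum_add_distrib]
  apply Finset.sum_eq_zero
  intro i _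
  ring

lemma row_Tu (hε : 0 < ε) (hn : 1 ≤ n) (hb : ∀ j, 0 < b j) (v : Fin n → ℝ) (w : ℝ) (i : Fin m) :
    ∑ j, P ε a b c (Tu ε a b c v w) v w i j
      = a i * Real.exp (∑ i', a i' * Real.log (Su ε b c v w i')) := by
  have hS := Su_pos (ε := ε) (c := c) hn hb v w i
  have h1 : Real.exp (Tu ε a b c v w i / ε)
      = Real.exp (∑ i', a i' * Real.log (Su ε b c v w i')) * (Su ε b c v w i)⁻¹ := by
    rw [← Real.exp_log (inv_pos.2 hS), ← Real.exp_add, Real.log_inv]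
    congr 1; unfold Tu; field_simp; ring
  have h2 : ∀ j, P ε a b c (Tu ε a b c v w) v w i j = a i * Real.exp (Tu ε a b c v w i / ε)
      * (Real.exp (-c w i j / ε) * (Real.exp (v j / ε) * b j)) := by
    intro j
    unfold P
    have : (Tu ε a b c v w i + v j - c w i j) / ε
      = Tu ε a b c v w i / ε + -c w i j / ε + v j / ε := by ring
    rw [this, Real.exp_add, Real.exp_add]; ring
  simp only [h2]
  rw [← Finset.mul_sum, h1]
  change _ * Su ε b c v w i = _
  field_simp

lemma col_Tv (hε : 0 < ε) (hm : 1 ≤ m) (ha : ∀ i, 0 < a i) (u : Fin m → ℝ) (w : ℝ) (j : Fin n) :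
    ∑ i, P ε a b c u (Tv ε a c u w) w i j = b j := by
  have hS := Sv_pos (ε := ε) (c := c) hm ha u w j
  have h1 : Real.exp (Tv ε a c u w j / ε) = (Sv ε a c u w j)⁻¹ := by
    rw [← Real.exp_log (inv_pos.2 hS), Real.log_inv]
    congr 1; unfold Tv; field_simp
  have h2 : ∀ i, P ε a b c u (Tv ε a c u w) w i j = b j * Real.exp (Tv ε a c u w j / ε)
      * (Real.exp (-c w i j / ε) * (Real.exp (u i / ε) * a i)) := by
    intro i
    unfold P
    have : (u i + Tv ε a c u w j - c w i j) / ε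
      = u i / ε + -c w i j / ε + Tv ε a c u w j / ε := by ring
    rw [this, Real.exp_add, Real.exp_add]; ring
  simp only [h2]
  rw [← Finset.mul_sum, h1]
  change _ * Sv ε a c u w j = _
  field_simp

/-- optimality from first-order conditions -/
lemma opt_of_kkt (hε : 0 < ε) (ha : ∀ i, 0 < a i) (hb : ∀ j, 0 < b j)
    (hc : ∀ w w' i j, c w' i j = c w i j + (w' - w) * B i j)
    (u : Fin m → ℝ) (v : Fin n → ℝ) (w : ℝ) (hu : ∑ i, a i * u i = 0) (μ : ℝ)
    (hr : ∀ i, ∑ j, P ε a b c u v w i j = a i * μ)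
    (hcol : ∀ j, ∑ i, P ε a b c u v w i j = b j)
    (hg : ∀ z ∈ Set.Icc (0 : ℝ) 1, 0 ≤ G ε a b B c u v w * (z - w))
    (u' : Fin m → ℝ) (v' : Fin n → ℝ) (w' : ℝ) (hu' : ∑ i, a i * u' i = 0)
    (hw' : w' ∈ Set.Icc (0 : ℝ) 1) :
    F ε a b c u v w ≤ F ε a b c u' v' w' := by
  have h := F_expand (a := a) (b := b) hε hc u v w u' v' w'
  have h0 := R_nonneg (c := c) hε ha hb u v w u' v' w'
  have h1 : ∑ i, ((∑ j, P ε a b c u v w i j) - a i) * (u' i - u i) = 0 := by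
    have : ∀ i, ((∑ j, P ε a b c u v w i j) - a i) * (u' i - u i)
        = (μ - 1) * (a i * u' i) - (μ - 1) * (a i * u i) := by
      intro i; rw [hr]; ring
    simp only [this]
    rw [Finset.sum_sub_distrib, ← Finset.mul_sum, ← Finset.mul_sum, hu, hu']; simp
  have h2 : ∑ j, ((∑ i, P ε a b c u v w i j) - b j) * (v' j - v j) = 0 := by
    apply Finset.sum_eq_zero; intro j _; rw [hcol]; ring
  have h3 := hg w' hw'
  linarith

lemma step_u (hε : 0 < ε) (hn : 1 ≤ n) (ha : ∀ i, 0 < a i) (hb : ∀ j, 0 < b j)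
    (ha1 : ∑ i, a i = 1)
    (hc : ∀ w w' i j, c w' i j = c w i j + (w' - w) * B i j)
    (u : Fin m → ℝ) (v : Fin n → ℝ) (w : ℝ) (hu : ∑ i, a i * u i = 0) :
    F ε a b c (Tu ε a b c v w) v w ≤ F ε a b c u v w ∧
    (F ε a b c (Tu ε a b c v w) v w = F ε a b c u v w → Tu ε a b c v w = u) := by
  set U := Tu ε a b c v w with hU
  have h := F_expand (a := a) (b := b) hε hc U v w u v w
  have h0 := R_nonneg (c := c) hε ha hb U v w u v w
  have hUf : ∑ i, a i * U i = 0 := Tu_feas ha1 v w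
  have h1 : ∑ i, ((∑ j, P ε a b c U v w i j) - a i) * (u i - U i) = 0 := by
    have : ∀ i, ((∑ j, P ε a b c U v w i j) - a i) * (u i - U i)
        = (Real.exp (∑ i', a i' * Real.log (Su ε b c v w i')) - 1) * (a i * u i)
        - (Real.exp (∑ i', a i' * Real.log (Su ε b c v w i')) - 1) * (a i * U i) := by
      intro i; rw [hU, row_Tu hε hn hb]; ring
    simp only [this]
    rw [Finset.sum_sub_distrib, ← Finset.mul_sum, ← Finset.mul_sum, hu, hUf]; simp
  have h2 : ∑ j, ((∑ i, P ε a b c U v w i j) - b j) * (v j - v j) = 0 := by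
    simp
  rw [h1, h2] at h
  simp only [sub_self, mul_zero, add_zero] at h
  refine ⟨by linarith, fun he => ?_⟩
  have hR : R ε a b c U v w u v w = 0 := by linarith
  funext i
  have := R_zero hε ha hb U v w u v w hR i ⟨0, hn⟩
  linarith

lemma step_v (hε : 0 < ε) (hm : 1 ≤ m) (ha : ∀ i, 0 < a i) (hb : ∀ j, 0 < b j)
    (hc : ∀ w w' i j, c w' i j = c w i j + (w' - w) * B i j)
    (u : Fin m → ℝ) (v : Fin n → ℝ) (w : ℝ) :
    F ε a b c u (Tv ε a c u w) w ≤ F ε a b c u v w ∧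
    (F ε a b c u (Tv ε a c u w) w = F ε a b c u v w → Tv ε a c u w = v) := by
  set V := Tv ε a c u w with hV
  have h := F_expand (a := a) (b := b) hε hc u V w u v w
  have h0 := R_nonneg (c := c) hε ha hb u V w u v w
  have h1 : ∑ i, ((∑ j, P ε a b c u V w i j) - a i) * (u i - u i) = 0 := by simp
  have h2 : ∑ j, ((∑ i, P ε a b c u V w i j) - b j) * (v j - V j) = 0 := by
    apply Finset.sum_eq_zero; intro j _; rw [hV, col_Tv hε hm ha]; ring
  rw [h1, h2] at h
  simp only [sub_self, mul_zero, add_zero] at h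
  refine ⟨by linarith, fun he => ?_⟩
  have hR : R ε a b c u V w u v w = 0 := by linarith
  funext j
  have := R_zero hε ha hb u V w u v w hR ⟨0, hm⟩ j
  linarith

lemma exp_rem_le (h : ℝ) : Real.exp h - 1 - h ≤ h ^ 2 * max 1 (Real.exp h) := by
  have h1 := Real.add_one_le_exp (-h)
  have h2 := Real.add_one_le_exp h
  have h3 := Real.exp_pos h
  have h4 : Real.exp (-h) * Real.exp h = 1 := by rw [← Real.exp_add]; simp
  have h5 : Real.exp h - 1 ≤ h * Real.exp h := by nlinarith
  rcases le_total 0 h with hh | hh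
  · have : h ^ 2 * Real.exp h ≤ h ^ 2 * max 1 (Real.exp h) := by gcongr; exact le_max_right _ _
    nlinarith
  · have : h ^ 2 * 1 ≤ h ^ 2 * max 1 (Real.exp h) := by gcongr; exact le_max_left _ _
    nlinarith

lemma w_R_le (hε : 0 < ε) (ha : ∀ i, 0 < a i) (hb : ∀ j, 0 < b j)
    (ha1 : ∑ i, a i = 1) (hb1 : ∑ j, b j = 1)
    (hc : ∀ w w' i j, c w' i j = c w i j + (w' - w) * B i j)
    (u : Fin m → ℝ) (v : Fin n → ℝ) (w w' K β : ℝ)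
    (hB : ∀ i j, |B i j| ≤ β)
    (hK : ∀ i j, (u i + v j - c w i j) / ε ≤ K) (hK' : ∀ i j, (u i + v j - c w' i j) / ε ≤ K) :
    R ε a b c u v w u v w' ≤ (β ^ 2 / ε * Real.exp K) * (w' - w) ^ 2 := by
  have key : ∀ i j, P ε a b c u v w i j *
      (Real.exp (H ε c u v w u v w' i j) - 1 - H ε c u v w u v w' i j)
      ≤ (a i * b j) * (β ^ 2 / ε ^ 2 * Real.exp K * (w' - w) ^ 2) := by
    intro i j
    have hab := mul_pos (ha i) (hb j)
    have e1 := exp_rem_le (H ε c u v w u v w' i j)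
    have e2 : Real.exp ((u i + v j - c w i j) / ε) * max 1 (Real.exp (H ε c u v w u v w' i j))
        ≤ Real.exp K := by
      rcases max_choice 1 (Real.exp (H ε c u v w u v w' i j)) with h | h <;> rw [h]
      · rw [mul_one]; exact Real.exp_le_exp.2 (hK i j)
      · rw [← Real.exp_add]; apply Real.exp_le_exp.2
        unfold H; linarith [hK' i j]
    have e3 : H ε c u v w u v w' i j ^ 2 ≤ β ^ 2 / ε ^ 2 * (w' - w) ^ 2 := by
      have : H ε c u v w u v w' i j = -((w' - w) * B i j) / ε := by
        unfold H; rw [hc w w' i j]; ring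
      rw [this, div_pow, neg_sq, mul_pow]
      have hB2 : B i j ^ 2 ≤ β ^ 2 := by
        rw [← sq_abs]; exact pow_le_pow_left₀ (abs_nonneg _) (hB i j) 2
      calc (w' - w) ^ 2 * B i j ^ 2 / ε ^ 2 ≤ (w' - w) ^ 2 * β ^ 2 / ε ^ 2 := by gcongr
        _ = _ := by ring
    unfold P
    calc Real.exp ((u i + v j - c w i j) / ε) * (a i * b j) *
          (Real.exp (H ε c u v w u v w' i j) - 1 - H ε c u v w u v w' i j)
        ≤ Real.exp ((u i + v j - c w i j) / ε) * (a i * b j) *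
          (H ε c u v w u v w' i j ^ 2 * max 1 (Real.exp (H ε c u v w u v w' i j))) := by
          gcongr
      _ = (a i * b j) * ((Real.exp ((u i + v j - c w i j) / ε) *
          max 1 (Real.exp (H ε c u v w u v w' i j))) * H ε c u v w u v w' i j ^ 2) := by ring
      _ ≤ (a i * b j) * (Real.exp K * (β ^ 2 / ε ^ 2 * (w' - w) ^ 2)) := by
          gcongr
      _ = _ := by ring
  unfold R
  calc _ ≤ ε * ∑ i, ∑ j, (a i * b j) * (β ^ 2 / ε ^ 2 * Real.exp K * (w' - w) ^ 2) := by
        apply mul_le_mul_of_nonneg_left _ hε.le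
        exact Finset.sum_le_sum fun i _ => Finset.sum_le_sum fun j _ => key i j
    _ = _ := by
        simp only [← Finset.sum_mul, ← Finset.mul_sum, hb1, mul_one, ha1]
        field_simp

lemma step_w (hε : 0 < ε) (ha : ∀ i, 0 < a i) (hb : ∀ j, 0 < b j)
    (ha1 : ∑ i, a i = 1) (hb1 : ∑ j, b j = 1)
    (hc : ∀ w w' i j, c w' i j = c w i j + (w' - w) * B i j)
    (u : Fin m → ℝ) (v : Fin n → ℝ) (w K β η : ℝ) (hw : w ∈ Set.Icc (0 : ℝ) 1)
    (hB : ∀ i j, |B i j| ≤ β)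
    (hK : ∀ z ∈ Set.Icc (0 : ℝ) 1, ∀ i j, (u i + v j - c z i j) / ε ≤ K)
    (hη : (0 < η ∧ η * (β ^ 2 / ε * Real.exp K) < 1) ∨ (η = 0 ∧ β = 0)) :
    F ε a b c u v (proj (w - η * G ε a b B c u v w)) ≤ F ε a b c u v w ∧
    (F ε a b c u v (proj (w - η * G ε a b B c u v w)) = F ε a b c u v w →
      proj (w - η * G ε a b B c u v w) = w ∧
      ∀ z ∈ Set.Icc (0 : ℝ) 1, 0 ≤ G ε a b B c u v w * (z - w)) := by
  rcases hη with ⟨h0, h1⟩ | ⟨h0, h1⟩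
  · set g := G ε a b B c u v w with hg
    set w' := proj (w - η * g) with hw'
    have hmem : w' ∈ Set.Icc (0 : ℝ) 1 := proj_mem _
    have h := F_expand (a := a) (b := b) hε hc u v w u v w'
    simp only [sub_self, mul_zero, Finset.sum_const_zero, add_zero] at h
    have hR := w_R_le hε ha hb ha1 hb1 hc u v w w' K β hB (hK w hw) (hK w' hmem)
    set L := β ^ 2 / ε * Real.exp K
    have hv := proj_var (w - η * g) w hw
    rw [← hw'] at hv
    rw [← hg] at h
    have hle : η * (F ε a b c u v w' - F ε a b c u v w) ≤ -(1 - η * L) * (w' - w) ^ 2 := by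
      rw [h]
      have := mul_le_mul_of_nonneg_left hR h0.le
      nlinarith
    have hneg : -(1 - η * L) * (w' - w) ^ 2 ≤ 0 := by nlinarith [sq_nonneg (w' - w)]
    refine ⟨?_, fun he => ?_⟩
    · by_contra hcon
      push Not at hcon
      have := mul_pos h0 (sub_pos.2 hcon)
      linarith
    · rw [he, sub_self, mul_zero] at hle
      have hsq : (w' - w) ^ 2 = 0 := by
        by_contra hne
        have : 0 < (w' - w) ^ 2 := lt_of_le_of_ne (sq_nonneg _) (Ne.symm hne)
        nlinarith
      have hww : w' = w := by
        have := pow_eq_zero_iff (two_ne_zero) |>.1 hsq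
        linarith
      refine ⟨hww, fun z hz => ?_⟩
      have := proj_var (w - η * g) z hz
      rw [← hw', hww] at this
      have h2 : 0 ≤ η * (g * (z - w)) := by linarith
      exact nonneg_of_mul_nonneg_right h2 h0
  · subst h0
    have hB0 : ∀ i j, B i j = 0 := fun i j => abs_eq_zero.1 (le_antisymm (h1 ▸ hB i j) (abs_nonneg _))
    have hG : G ε a b B c u v w = 0 := by unfold G; simp [hB0]
    rw [zero_mul, sub_zero, proj_self w hw]
    refine ⟨le_refl _, fun _ => ⟨rfl, fun z _ => ?_⟩⟩
    rw [hG, zero_mul]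

lemma Tu_bound (hε : 0 < ε) (hn : 1 ≤ n) (ha : ∀ i, 0 < a i) (hb : ∀ j, 0 < b j)
    (ha1 : ∑ i, a i = 1) (M w : ℝ)
    (hM : ∀ i j, 0 ≤ c w i j ∧ c w i j ≤ M) (v : Fin n → ℝ) (i : Fin m) :
    |Tu ε a b c v w i| ≤ M := by
  have hS : ∀ i, 0 < Su ε b c v w i := fun i => Su_pos hn hb v w i
  have h1 : ∀ i i', Real.log (Su ε b c v w i) ≤ M / ε + Real.log (Su ε b c v w i') := by
    intro i i'
    rw [← Real.log_exp (M / ε), ← Real.log_mul (Real.exp_pos _).ne' (hS i').ne']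
    apply Real.log_le_log (hS i)
    unfold Su
    rw [Finset.mul_sum]
    apply Finset.sum_le_sum
    intro j _
    rw [← mul_assoc (Real.exp (M / ε)), ← Real.exp_add]
    apply mul_le_mul_of_nonneg_right _ (mul_pos (Real.exp_pos _) (hb j)).le
    apply Real.exp_le_exp.2
    rw [← add_div]
    apply div_le_div_of_nonneg_right _ hε.le
    linarith [hM i j, hM i' j]
  have h2 : Tu ε a b c v w i
      = ε * ∑ i', a i' * (Real.log (Su ε b c v w i') - Real.log (Su ε b c v w i)) := by
    unfold Tu
    simp only [mul_sub, Finset.sum_sub_distrib]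
    rw [← Finset.sum_mul, ha1]; ring
  have hM' : M = ε * ∑ i', a i' * (M / ε) := by
    rw [← Finset.sum_mul, ha1]; field_simp
  rw [h2, abs_le]
  constructor
  · have : -M = ε * ∑ i', a i' * (-(M / ε)) := by
      rw [← Finset.sum_mul, ha1]; field_simp
    rw [this]
    apply mul_le_mul_of_nonneg_left _ hε.le
    apply Finset.sum_le_sum
    intro i' _
    apply mul_le_mul_of_nonneg_left _ (ha i').le
    linarith [h1 i i']
  · conv_rhs => rw [hM']
    apply mul_le_mul_of_nonneg_left _ hε.le
    apply Finset.sum_le_sum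
    intro i' _
    apply mul_le_mul_of_nonneg_left _ (ha i').le
    linarith [h1 i' i]

lemma Tv_bound (hε : 0 < ε) (hm : 1 ≤ m) (ha : ∀ i, 0 < a i)
    (ha1 : ∑ i, a i = 1) (M w : ℝ)
    (hM : ∀ i j, 0 ≤ c w i j ∧ c w i j ≤ M) (u : Fin m → ℝ) (hu : ∀ i, |u i| ≤ M) (j : Fin n) :
    |Tv ε a c u w j| ≤ 2 * M := by
  have hS : 0 < Sv ε a c u w j := Sv_pos hm ha u w j
  have hM0 : 0 ≤ M := (abs_nonneg _).trans (hu ⟨0, hm⟩)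
  have e : ∀ i, Real.exp (-c w i j / ε) * (Real.exp (u i / ε) * a i)
      = a i * Real.exp ((u i - c w i j) / ε) := by
    intro i
    rw [← mul_assoc, ← Real.exp_add, mul_comm]; congr 2; ring
  have up : Real.log (Sv ε a c u w j) ≤ M / ε := by
    rw [Real.log_le_iff_le_exp hS]
    have : Real.exp (M / ε) = ∑ i, a i * Real.exp (M / ε) := by rw [← Finset.sum_mul, ha1, one_mul]
    rw [this]; unfold Sv
    apply Finset.sum_le_sum
    intro i _
    rw [e]
    apply mul_le_mul_of_nonneg_left _ (ha i).le
    apply Real.exp_le_exp.2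
    apply div_le_div_of_nonneg_right _ hε.le
    linarith [hM i j, (abs_le.1 (hu i)).2]
  have lo : -(2 * M) / ε ≤ Real.log (Sv ε a c u w j) := by
    rw [Real.le_log_iff_exp_le hS]
    have : Real.exp (-(2 * M) / ε) = ∑ i, a i * Real.exp (-(2 * M) / ε) := by
      rw [← Finset.sum_mul, ha1, one_mul]
    rw [this]; unfold Sv
    apply Finset.sum_le_sum
    intro i _
    rw [e]
    apply mul_le_mul_of_nonneg_left _ (ha i).le
    apply Real.exp_le_exp.2
    apply div_le_div_of_nonneg_right _ hε.le
    linarith [hM i j, (abs_le.1 (hu i)).1]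
  rw [le_div_iff₀ hε] at up
  rw [div_le_iff₀ hε] at lo
  unfold Tv
  rw [abs_le]
  constructor <;> linarith

/-- the full map -/
def T (ε η : ℝ) (a : Fin m → ℝ) (b : Fin n → ℝ) (B : Matrix (Fin m) (Fin n) ℝ)
    (c : ℝ → Matrix (Fin m) (Fin n) ℝ)
    (ζ : (Fin m → ℝ) × (Fin n → ℝ) × ℝ) : (Fin m → ℝ) × (Fin n → ℝ) × ℝ :=
  (Tu ε a b c ζ.2.1 ζ.2.2, Tv ε a c (Tu ε a b c ζ.2.1 ζ.2.2) ζ.2.2,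
    proj (ζ.2.2 - η * G ε a b B c (Tu ε a b c ζ.2.1 ζ.2.2)
      (Tv ε a c (Tu ε a b c ζ.2.1 ζ.2.2) ζ.2.2) ζ.2.2))

/-- objective on triples -/
def FF (ε : ℝ) (a : Fin m → ℝ) (b : Fin n → ℝ) (c : ℝ → Matrix (Fin m) (Fin n) ℝ)
    (ζ : (Fin m → ℝ) × (Fin n → ℝ) × ℝ) : ℝ := F ε a b c ζ.1 ζ.2.1 ζ.2.2

lemma T_descent (hε : 0 < ε) (hm : 1 ≤ m) (hn : 1 ≤ n) (ha : ∀ i, 0 < a i) (hb : ∀ j, 0 < b j)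
    (ha1 : ∑ i, a i = 1) (hb1 : ∑ j, b j = 1)
    (hc : ∀ w w' i j, c w' i j = c w i j + (w' - w) * B i j)
    (M β η : ℝ) (hM : ∀ w ∈ Set.Icc (0 : ℝ) 1, ∀ i j, 0 ≤ c w i j ∧ c w i j ≤ M)
    (hB : ∀ i j, |B i j| ≤ β)
    (hη : (0 < η ∧ η * (β ^ 2 / ε * Real.exp (3 * M / ε)) < 1) ∨ (η = 0 ∧ β = 0))
    (ζ : (Fin m → ℝ) × (Fin n → ℝ) × ℝ) (hζ : ζ ∈ feasSet (n := n) a) :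
    FF ε a b c (T ε η a b B c ζ) ≤ FF ε a b c ζ ∧
    (FF ε a b c (T ε η a b B c ζ) = FF ε a b c ζ →
      ∀ ζ' ∈ feasSet (n := n) a, FF ε a b c ζ ≤ FF ε a b c ζ') := by
  obtain ⟨u, v, w⟩ := ζ
  obtain ⟨hu, hw⟩ := hζ
  simp only at hu hw
  have s1 := step_u hε hn ha hb ha1 hc u v w hu
  have hTu := Tu_bound hε hn ha hb ha1 M w (hM w hw) v
  have hrow := row_Tu (a := a) (c := c) hε hn hb v w
  unfold FF T
  simp only
  set U := Tu ε a b c v w with hU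
  have s2 := step_v hε hm ha hb hc U v w
  have hTv := Tv_bound hε hm ha ha1 M w (hM w hw) U hTu
  have hcol := col_Tv (b := b) (c := c) hε hm ha U w
  set V := Tv ε a c U w with hV
  have s3 := step_w hε ha hb ha1 hb1 hc U V w (3 * M / ε) β η hw hB (by
    intro z hz i j
    apply div_le_div_of_nonneg_right _ hε.le
    linarith [hM z hz i j, (abs_le.1 (hTu i)).2, (abs_le.1 (hTv j)).2]) hη
  refine ⟨by linarith [s1.1, s2.1, s3.1], fun he ζ' hζ' => ?_⟩
  have hUu := s1.2 (by linarith [s1.1, s2.1, s3.1])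
  have hVv := s2.2 (by linarith [s1.1, s2.1, s3.1])
  have hww := s3.2 (by linarith [s1.1, s2.1, s3.1])
  rw [hVv, hUu] at hcol hww
  rw [hUu] at hrow
  exact opt_of_kkt hε ha hb hc u v w hu _ hrow hcol hww.2 ζ'.1 ζ'.2.1 ζ'.2.2 hζ'.1 hζ'.2

lemma FF_cont (hcc : ∀ i j, Continuous fun w => c w i j) : Continuous (FF ε a b c) := by
  unfold FF F
  have : ∀ i j, Continuous fun ζ : (Fin m → ℝ) × (Fin n → ℝ) × ℝ => c ζ.2.2 i j := fun i j =>
    (hcc i j).comp (by fun_prop)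
  fun_prop

lemma T_cont (hm : 1 ≤ m) (hn : 1 ≤ n) (ha : ∀ i, 0 < a i) (hb : ∀ j, 0 < b j) (η : ℝ)
    (hcc : ∀ i j, Continuous fun w => c w i j) : Continuous (T ε η a b B c) := by
  have hc' : ∀ i j, Continuous fun ζ : (Fin m → ℝ) × (Fin n → ℝ) × ℝ => c ζ.2.2 i j := fun i j =>
    (hcc i j).comp (by fun_prop)
  have hSu : ∀ i, Continuous fun ζ : (Fin m → ℝ) × (Fin n → ℝ) × ℝ =>
      Real.log (Su ε b c ζ.2.1 ζ.2.2 i) := fun i => by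
    apply Continuous.log _ (fun ζ => (Su_pos hn hb _ _ i).ne')
    unfold Su; fun_prop
  have hTu : ∀ i, Continuous fun ζ : (Fin m → ℝ) × (Fin n → ℝ) × ℝ =>
      Tu ε a b c ζ.2.1 ζ.2.2 i := fun i => by unfold Tu; fun_prop
  have hTv : ∀ j, Continuous fun ζ : (Fin m → ℝ) × (Fin n → ℝ) × ℝ =>
      Tv ε a c (Tu ε a b c ζ.2.1 ζ.2.2) ζ.2.2 j := fun j => by
    unfold Tv
    apply Continuous.mul continuous_const
    apply Continuous.log _ (fun ζ => (Sv_pos hm ha _ _ j).ne')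
    unfold Sv; fun_prop
  unfold T
  refine (continuous_pi hTu).prodMk ((continuous_pi hTv).prodMk ?_)
  unfold proj G
  fun_prop

/-- compact set holding the iterates -/
def KK (m n : ℕ) (M : ℝ) : Set ((Fin m → ℝ) × (Fin n → ℝ) × ℝ) :=
  (Set.pi Set.univ fun _ => Set.Icc (-M) M) ×ˢ
    ((Set.pi Set.univ fun _ => Set.Icc (-(2 * M)) (2 * M)) ×ˢ Set.Icc (0 : ℝ) 1)

lemma KK_compact (M : ℝ) : IsCompact (KK m n M) :=
  (isCompact_univ_pi fun _ => isCompact_Icc).prod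
    ((isCompact_univ_pi fun _ => isCompact_Icc).prod isCompact_Icc)

lemma feas_closed : IsClosed (feasSet (n := n) a) := by
  unfold feasSet
  apply IsClosed.inter
  · exact isClosed_eq (by fun_prop) continuous_const
  · exact isClosed_Icc.preimage (by fun_prop)

lemma T_mem (hε : 0 < ε) (hm : 1 ≤ m) (hn : 1 ≤ n) (ha : ∀ i, 0 < a i) (hb : ∀ j, 0 < b j)
    (ha1 : ∑ i, a i = 1)
    (M η : ℝ) (hM : ∀ w ∈ Set.Icc (0 : ℝ) 1, ∀ i j, 0 ≤ c w i j ∧ c w i j ≤ M)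
    (ζ : (Fin m → ℝ) × (Fin n → ℝ) × ℝ) (hζ : ζ.2.2 ∈ Set.Icc (0 : ℝ) 1) :
    T ε η a b B c ζ ∈ KK m n M ∧ T ε η a b B c ζ ∈ feasSet (n := n) a := by
  have hTu := Tu_bound hε hn ha hb ha1 M ζ.2.2 (hM _ hζ) ζ.2.1
  have hTv := Tv_bound hε hm ha ha1 M ζ.2.2 (hM _ hζ) _ hTu
  refine ⟨⟨fun i _ => abs_le.1 (hTu i), fun j _ => abs_le.1 (hTv j), proj_mem _⟩,
    Tu_feas ha1 _ _, proj_mem _⟩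

lemma dist2_cont (ζ : (Fin m → ℝ) × (Fin n → ℝ) × ℝ) : Continuous fun ξ => dist2 ξ ζ := by
  unfold dist2
  fun_prop

lemma main (hε : 0 < ε) (hm : 1 ≤ m) (hn : 1 ≤ n) (ha : ∀ i, 0 < a i) (hb : ∀ j, 0 < b j)
    (ha1 : ∑ i, a i = 1) (hb1 : ∑ j, b j = 1)
    (hc : ∀ w w' i j, c w' i j = c w i j + (w' - w) * B i j)
    (M β η : ℝ) (hM : ∀ w ∈ Set.Icc (0 : ℝ) 1, ∀ i j, 0 ≤ c w i j ∧ c w i j ≤ M)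
    (hB : ∀ i j, |B i j| ≤ β)
    (hη : (0 < η ∧ η * (β ^ 2 / ε * Real.exp (3 * M / ε)) < 1) ∨ (η = 0 ∧ β = 0))
    (S : Set ((Fin m → ℝ) × (Fin n → ℝ) × ℝ))
    (hS : ∀ ζ ∈ feasSet (n := n) a, (∀ ζ' ∈ feasSet (n := n) a, FF ε a b c ζ ≤ FF ε a b c ζ') →
      ζ ∈ S)
    (ξ : ℕ → (Fin m → ℝ) × (Fin n → ℝ) × ℝ) (h0 : (ξ 0).2.2 ∈ Set.Icc (0 : ℝ) 1)
    (hξ : ∀ k, ξ (k + 1) = T ε η a b B c (ξ k)) :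
    Tendsto (fun k => sInf {r : ℝ | ∃ ζ ∈ S, r = dist2 (ξ k) ζ}) atTop (𝓝 0) := by
  have hcc : ∀ i j, Continuous fun w => c w i j := fun i j => by
    have : (fun w => c w i j) = fun w => c 0 i j + (w - 0) * B i j := funext fun w => hc 0 w i j
    rw [this]; fun_prop
  have hFc : Continuous (FF ε a b c) := FF_cont hcc
  have hTc : Continuous (T ε η a b B c) := T_cont hm hn ha hb η hcc
  have hw : ∀ k, (ξ k).2.2 ∈ Set.Icc (0 : ℝ) 1 := by
    intro k
    cases k with
    | zero => exact h0
    | succ k => rw [hξ]; exact proj_mem _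
  have hmem : ∀ k, ξ (k + 1) ∈ KK m n M ∧ ξ (k + 1) ∈ feasSet (n := n) a := fun k => by
    rw [hξ]; exact T_mem hε hm hn ha hb ha1 M η hM _ (hw k)
  have hanti : Antitone fun k => FF ε a b c (ξ (k + 1)) := by
    apply antitone_nat_of_succ_le
    intro k
    rw [hξ (k + 1)]
    exact (T_descent hε hm hn ha hb ha1 hb1 hc M β η hM hB hη _ (hmem k).2).1
  obtain ⟨lb, hlb⟩ := ((KK_compact (m := m) (n := n) M).image hFc).bddBelow
  have hbdd : BddBelow (Set.range fun k => FF ε a b c (ξ (k + 1))) := by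
    refine ⟨lb, ?_⟩
    rintro _ ⟨k, rfl⟩
    exact hlb ⟨_, (hmem k).1, rfl⟩
  have hlim := tendsto_atTop_ciInf hanti hbdd
  set ℓ := ⨅ k, FF ε a b c (ξ (k + 1))
  have hlim0 : Tendsto (fun k => FF ε a b c (ξ k)) atTop (𝓝 ℓ) :=
    (tendsto_add_atTop_iff_nat 1).1 hlim
  rw [← tendsto_add_atTop_iff_nat 1]
  apply tendsto_of_subseq_tendsto
  intro ns hns
  obtain ⟨ζ, hζK, φ, hφ, hφl⟩ := (KK_compact (m := m) (n := n) M).tendsto_subseq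
    (x := fun k => ξ (ns k + 1)) (fun k => (hmem _).1)
  refine ⟨φ, ?_⟩
  have hφl' : Tendsto (fun k => ξ (ns (φ k) + 1)) atTop (𝓝 ζ) := hφl
  have hidx : Tendsto (fun k => ns (φ k)) atTop atTop := hns.comp hφ.tendsto_atTop
  have hζf : ζ ∈ feasSet (n := n) a :=
    feas_closed.mem_of_tendsto hφl' (Eventually.of_forall fun k => (hmem _).2)
  have l1 : FF ε a b c ζ = ℓ :=
    tendsto_nhds_unique ((hFc.tendsto ζ).comp hφl') (hlim.comp hidx)
  have l2 : FF ε a b c (T ε η a b B c ζ) = ℓ := by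
    have t1 : Tendsto (fun k => FF ε a b c (ξ (ns (φ k) + 1 + 1))) atTop
        (𝓝 (FF ε a b c (T ε η a b B c ζ))) := by
      simp only [hξ (_ + 1)]
      exact ((hFc.comp hTc).tendsto ζ).comp hφl'
    have t2 : Tendsto (fun k => FF ε a b c (ξ (ns (φ k) + 1 + 1))) atTop (𝓝 ℓ) :=
      ((tendsto_add_atTop_iff_nat 1).2 hlim).comp hidx
    exact tendsto_nhds_unique t1 t2
  have hopt : ζ ∈ S := hS ζ hζf
    ((T_descent hε hm hn ha hb ha1 hb1 hc M β η hM hB hη ζ hζf).2 (l2.trans l1.symm))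
  have hd : Tendsto (fun k => dist2 (ξ (ns (φ k) + 1)) ζ) atTop (𝓝 0) := by
    have := ((dist2_cont ζ).tendsto ζ).comp hφl'
    have hz : dist2 ζ ζ = 0 := by unfold dist2; simp
    rw [hz] at this
    exact this
  refine squeeze_zero (fun k => ?_) (fun k => ?_) hd
  · apply Real.sInf_nonneg
    rintro r ⟨z, _, rfl⟩
    exact Real.sqrt_nonneg _
  · apply csInf_le
    · refine ⟨0, ?_⟩
      rintro r ⟨z, _, rfl⟩
      exact Real.sqrt_nonneg _
    · exact ⟨ζ, hopt, rfl⟩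

lemma le_matSup (C : Matrix (Fin m) (Fin n) ℝ) (i : Fin m) (j : Fin n) :
    |C i j| ≤ matSup C := by
  unfold matSup
  calc |C i j| ≤ ⨆ j, |C i j| := le_ciSup (f := fun j => |C i j|) (Set.finite_range _).bddAbove j
    _ ≤ _ := le_ciSup (f := fun i => ⨆ j, |C i j|) (Set.finite_range _).bddAbove i

end

end HBCDAux

/-- The HBCD iterates with stepsize `η = (ε/‖C̃‖_∞²) exp(−6‖C‖_∞/ε)`
converge to the optimal solution set `S̃` of the dual entropic TiOT problem:
`lim_{k→∞} inf_{ξ ∈ S̃} ‖ξ^k − ξ‖₂ = 0`. -/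
theorem HBCD_converges_to_optSet {d m n : ℕ} (hm : 1 ≤ m) (hn : 1 ≤ n)
    (p ε η : ℝ) (hp : 1 ≤ p) (hε : 0 < ε)
    (a : Fin m → ℝ) (b : Fin n → ℝ)
    (ha : ∀ i, 0 < a i) (ha1 : ∑ i, a i = 1) (hb : ∀ j, 0 < b j) (hb1 : ∑ j, b j = 1)
    (x : Fin m → Fin d → ℝ) (t : Fin m → ℝ) (y : Fin n → Fin d → ℝ) (s : Fin n → ℝ)
    (hη : η = (ε / matSup (tildeC p x t y s) ^ 2) *
      Real.exp (-(6 * CsupNorm p x t y s) / ε))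
    (u : ℕ → Fin m → ℝ) (v : ℕ → Fin n → ℝ) (w : ℕ → ℝ)
    (hw0 : w 0 ∈ Set.Icc (0 : ℝ) 1)
    (hseq : HBCDseq p ε η a b x t y s u v w) :
    Tendsto (fun k => sInf {r : ℝ | ∃ ζ ∈ optSet p ε a b x t y s,
        r = dist2 (u k, v k, w k) ζ}) atTop (𝓝 0) := by
  have hcst : ∀ w w' i j, costM p x t y s w' i j
      = costM p x t y s w i j + (w' - w) * tildeC p x t y s i j := by
    intro w w' i j; unfold costM tildeC; ring
  have hpos : ∀ w ∈ Set.Icc (0 : ℝ) 1, ∀ i j, 0 ≤ costM p x t y s w i j ∧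
      costM p x t y s w i j ≤ CsupNorm p x t y s := by
    intro w hw i j
    have h0 : costM p x t y s 0 i j ≤ CsupNorm p x t y s := (le_abs_self _).trans
      ((HBCDAux.le_matSup (costM p x t y s 0) i j).trans (le_max_left _ _ :
        _ ≤ CsupNorm p x t y s))
    have h1 : costM p x t y s 1 i j ≤ CsupNorm p x t y s := (le_abs_self _).trans
      ((HBCDAux.le_matSup (costM p x t y s 1) i j).trans (le_max_right _ _ :
        _ ≤ CsupNorm p x t y s))
    have hA : 0 ≤ ∑ l, |x i l - y j l| ^ p :=
      Finset.sum_nonneg fun l _ => Real.rpow_nonneg (abs_nonneg _) _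
    have hT : 0 ≤ |t i - s j| ^ p := Real.rpow_nonneg (abs_nonneg _) _
    generalize CsupNorm p x t y s = M at h0 h1 ⊢
    unfold costM at h0 h1 ⊢
    simp only [zero_mul, zero_add, sub_zero, one_mul, sub_self, add_zero] at h0 h1
    obtain ⟨hw1, hw2⟩ := hw
    constructor
    · have := mul_nonneg hw1 hA
      have := mul_nonneg (sub_nonneg.2 hw2) hT
      linarith
    · have := mul_le_mul_of_nonneg_left h1 hw1
      have := mul_le_mul_of_nonneg_left h0 (sub_nonneg.2 hw2)
      linarith
  have hBβ := HBCDAux.le_matSup (tildeC p x t y s)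
  set β := matSup (tildeC p x t y s) with hβ
  set M := CsupNorm p x t y s with hMdef
  have hβ0 : 0 ≤ β := (abs_nonneg _).trans (hBβ ⟨0, hm⟩ ⟨0, hn⟩)
  have hM0 : 0 ≤ M := by
    have := hpos 0 ⟨le_refl _, zero_le_one⟩ ⟨0, hm⟩ ⟨0, hn⟩
    linarith
  have hηc : (0 < η ∧ η * (β ^ 2 / ε * Real.exp (3 * M / ε)) < 1) ∨ (η = 0 ∧ β = 0) := by
    rcases hβ0.eq_or_lt with hz | hz
    · right
      refine ⟨?_, hz.symm⟩
      rw [hη, ← hz]; simp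
    · left
      have hMp : 0 < M := by
        rcases hM0.eq_or_lt with h | h
        · exfalso
          have hB0 : ∀ i j, tildeC p x t y s i j = 0 := by
            intro i j
            have h0 := hpos 0 ⟨le_refl _, zero_le_one⟩ i j
            have h1 := hpos 1 ⟨zero_le_one, le_refl _⟩ i j
            have := hcst 0 1 i j
            linarith
          have : β = 0 := by rw [hβ]; unfold matSup; simp [hB0]
          linarith
        · exact h
      have e : η * (β ^ 2 / ε * Real.exp (3 * M / ε)) = Real.exp (-(3 * M / ε)) := by
        have h2 : Real.exp (-(3 * M / ε)) = Real.exp (-(6 * M) / ε) * Real.exp (3 * M / ε) := by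
          rw [← Real.exp_add]; congr 1; ring
        rw [h2, hη]; field_simp
      refine ⟨by rw [hη]; positivity, ?_⟩
      rw [e, Real.exp_lt_one_iff]
      have : 0 < 3 * M / ε := by positivity
      linarith
  exact HBCDAux.main hε hm hn ha hb ha1 hb1 hcst M β η hpos hBβ hηc (optSet p ε a b x t y s)
    (fun ζ h1 h2 => ⟨h1, h2⟩) (fun k => (u k, v k, w k)) hw0 (by
      intro k
      obtain ⟨h1, h2, h3⟩ := hseq k
      have e1 : u (k + 1) = HBCDAux.Tu ε a b (costM p x t y s) (v k) (w k) := h1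
      have e2 : v (k + 1) = HBCDAux.Tv ε a (costM p x t y s) (u (k + 1)) (w k) := h2
      have e3 : w (k + 1) = HBCDAux.proj (w k - η * HBCDAux.G ε a b (tildeC p x t y s)
        (costM p x t y s) (u (k + 1)) (v (k + 1)) (w k)) := h3
      unfold HBCDAux.T
      simp only
      rw [← e1, ← e2, ← e3])
end
end
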